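/- arXiv:2308.01580 — 3 statements merged into one kernel-verified Lean document; each statement's English description precedes it below -/
import Mathlib

section
/- Let N be a positive integer, h = 1/N, and let S_h be the discrete Hardy constant for the uniform mesh of size h. Then, as N → ∞, the quantity (S_h − 1/4 − π²/(log h)²)·(log h)² tends to 0; equivalently, S_h = 1/4 + π²/|log h|² + o(1/|log h|²) as h → 0. -/
open MeasureTheory Real Set Filter

noncomputable section

/-- Membership in the finite element space `V_h` with `h = 1/N`: continuous on `[0,1]`
and affine on each mesh interval `[k/N, (k+1)/N]`. -/
def MemVh (N : ℕ) (v : ℝ → ℝ) : Prop :=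
  ContinuousOn v (Set.Icc 0 1) ∧
  ∀ k : ℕ, k < N → ∃ a b : ℝ,
    ∀ x ∈ Set.Icc ((k : ℝ) / (N : ℝ)) (((k : ℝ) + 1) / (N : ℝ)), v x = a * x + b

/-- The discrete Hardy constant `S_h` for the uniform mesh of size `h = 1/N`. -/
def Sdisc (N : ℕ) : ℝ :=
  sInf { s : ℝ | ∃ v : ℝ → ℝ, MemVh N v ∧ v 0 = 0 ∧ (∃ x ∈ Set.Icc (0:ℝ) 1, v x ≠ 0) ∧
    s = (∫ x in (0:ℝ)..1, (deriv v x) ^ 2) / (∫ x in (0:ℝ)..1, (v x) ^ 2 / x ^ 2) }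

lemma cell_deriv {v : ℝ → ℝ} {α β p q : ℝ}
    (hv : ∀ x ∈ Set.Icc p q, v x = α * x + β) : ∀ x ∈ Set.Ioo p q, deriv v x = α := by
  intro x hx
  have h : v =ᶠ[nhds x] fun x => α * x + β := by
    filter_upwards [Ioo_mem_nhds hx.1 hx.2] with y hy
    exact hv y ⟨hy.1.le, hy.2.le⟩
  rw [h.deriv_eq]
  have : HasDerivAt (fun x : ℝ => α * x + β) (α * 1) x :=
    ((hasDerivAt_id x).const_mul α).add_const β
  simpa using this.deriv

lemma cell_energy_int {v : ℝ → ℝ} {α β p q : ℝ} (hpq : p ≤ q)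
    (hv : ∀ x ∈ Set.Icc p q, v x = α * x + β) :
    IntervalIntegrable (fun x => (deriv v x) ^ 2) volume p q ∧
    ∫ x in p..q, (deriv v x) ^ 2 = α ^ 2 * (q - p) := by
  have h : Set.EqOn (fun _ : ℝ => α ^ 2) (fun x => (deriv v x) ^ 2) (Set.uIoo p q) := by
    rw [Set.uIoo_of_le hpq]
    intro x hx
    simp [cell_deriv hv x hx]
  refine ⟨(intervalIntegrable_const).congr_uIoo h, ?_⟩
  rw [← intervalIntegral.integral_congr_uIoo h]
  simp [mul_comm]

lemma cell_weight_int {v : ℝ → ℝ} {α β p q : ℝ} (hp : 0 ≤ p) (hpq : p ≤ q) (hpβ : p = 0 → β = 0)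
    (hv : ∀ x ∈ Set.Icc p q, v x = α * x + β) :
    IntervalIntegrable (fun x => (v x) ^ 2 / x ^ 2) volume p q ∧
    ∫ x in p..q, (v x) ^ 2 / x ^ 2 = ∫ x in p..q, (α * x + β) ^ 2 / x ^ 2 := by
  have h : Set.EqOn (fun x => (α * x + β) ^ 2 / x ^ 2) (fun x => (v x) ^ 2 / x ^ 2)
      (Set.uIoo p q) := by
    rw [Set.uIoo_of_le hpq]
    intro x hx
    simp [hv x ⟨hx.1.le, hx.2.le⟩]
  refine ⟨?_, (intervalIntegral.integral_congr_uIoo h).symm⟩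
  refine IntervalIntegrable.congr_uIoo ?_ h
  rcases hp.eq_or_lt with h0 | h0
  · have h2 : Set.EqOn (fun _ : ℝ => α ^ 2) (fun x => (α * x + β) ^ 2 / x ^ 2)
      (Set.uIoo p q) := by
      rw [Set.uIoo_of_le hpq]
      intro x hx
      have : x ≠ 0 := by
        have := hx.1
        linarith
      simp only [hpβ h0.symm]
      field_simp
      ring
    exact (intervalIntegrable_const).congr_uIoo h2
  · apply ContinuousOn.intervalIntegrable
    rw [Set.uIcc_of_le hpq]
    apply ContinuousOn.div (by fun_prop) (by fun_prop)
    intro x hx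
    have : 0 < x := lt_of_lt_of_le h0 hx.1
    positivity

def gg (μ c x : ℝ) : ℝ := (1/2 + μ * (cos (μ * log x + c) / sin (μ * log x + c))) / x

lemma gg_deriv (μ c x : ℝ) (hx : 0 < x) (hs : 0 < sin (μ * log x + c)) :
    HasDerivAt (gg μ c) (-(1/4 + μ^2) / x^2 - (gg μ c x)^2) x := by
  have ht : HasDerivAt (fun x => μ * log x + c) (μ * x⁻¹) x :=
    ((hasDerivAt_log hx.ne').const_mul μ).add_const c
  have h := (((ht.cos.fun_div ht.sin hs.ne').const_mul μ).const_add (1/2)).fun_div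
    (hasDerivAt_id x) hx.ne'
  unfold gg
  convert! h using 1
  have e := sin_sq_add_cos_sq (μ * log x + c)
  simp only [id]
  set S := sin (μ * log x + c)
  set C := cos (μ * log x + c)
  have : C ^ 2 = 1 - S ^ 2 := by linarith
  field_simp
  ring_nf
  try rw [this]
  try ring

lemma cell_lower (μ c α β p q : ℝ) (hp : 0 < p) (hpq : p ≤ q)
    (hs : ∀ x ∈ Set.Icc p q, 0 < sin (μ * log x + c)) :
    gg μ c q * (α * q + β) ^ 2 - gg μ c p * (α * p + β) ^ 2
      + (1/4 + μ^2) * ∫ x in p..q, (α * x + β) ^ 2 / x ^ 2 ≤ α ^ 2 * (q - p) := by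
  have hc : ContinuousOn (fun x => (α * x + β) ^ 2 / x ^ 2) (Set.Icc p q) := by
    apply ContinuousOn.div (by fun_prop) (by fun_prop)
    intro x hx
    have : 0 < x := lt_of_lt_of_le hp hx.1
    positivity
  have hd : ∀ x ∈ Set.Icc p q, HasDerivAt (fun x => gg μ c x * (α * x + β) ^ 2)
      ((-(1/4 + μ^2) / x^2 - (gg μ c x)^2) * (α * x + β) ^ 2
        + gg μ c x * (2 * (α * x + β) * α)) x := by
    intro x hx
    have h1 : HasDerivAt (fun x : ℝ => α * x + β) α x := by
      simpa using ((hasDerivAt_id x).const_mul α).add_const β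
    have := (gg_deriv μ c x (lt_of_lt_of_le hp hx.1) (hs x hx)).fun_mul (h1.fun_pow 2)
    simpa using this
  have key := intervalIntegral.sub_le_integral_of_hasDeriv_right_of_le
    (g := fun x => gg μ c x * (α * x + β) ^ 2)
    (φ := fun x => α ^ 2 - (1/4 + μ^2) * ((α * x + β) ^ 2 / x ^ 2)) hpq
    (fun x hx => (hd x hx).continuousAt.continuousWithinAt)
    (fun x hx => (hd x ⟨hx.1.le, hx.2.le⟩).hasDerivWithinAt)
    ((continuousOn_const.sub (continuousOn_const.mul hc)).integrableOn_Icc)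
    (by
      intro x hx
      have := sq_nonneg (α - gg μ c x * (α * x + β))
      have e : -(1/4 + μ^2) / x^2 * (α * x + β) ^ 2
        = - ((1/4 + μ^2) * ((α * x + β) ^ 2 / x ^ 2)) := by ring
      nlinarith)
  have hi : IntervalIntegrable (fun x => (α * x + β) ^ 2 / x ^ 2) volume p q := by
    apply ContinuousOn.intervalIntegrable
    rwa [Set.uIcc_of_le hpq]
  rw [intervalIntegral.integral_sub intervalIntegrable_const (hi.const_mul _),
    intervalIntegral.integral_const_mul, intervalIntegral.integral_const] at key
  simp only [smul_eq_mul] at key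
  linarith

lemma decomp (N : ℕ) (hN : 0 < N) (v : ℝ → ℝ) (hv : MemVh N v) (h0 : v 0 = 0) :
    ∃ α β : ℕ → ℝ, (∀ k < N, ∀ x ∈ Set.Icc ((k : ℝ) / N) (((k : ℝ) + 1) / N),
        v x = α k * x + β k) ∧ β 0 = 0 ∧
      IntervalIntegrable (fun x => (v x) ^ 2 / x ^ 2) volume 0 1 ∧
      (∫ x in (0:ℝ)..1, (deriv v x) ^ 2)
        = ∑ k ∈ Finset.range N, α k ^ 2 * (((k : ℝ) + 1) / N - (k : ℝ) / N) ∧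
      (∫ x in (0:ℝ)..1, (v x) ^ 2 / x ^ 2)
        = ∑ k ∈ Finset.range N, ∫ x in ((k : ℝ) / N)..(((k : ℝ) + 1) / N),
            (α k * x + β k) ^ 2 / x ^ 2 := by
  have hN' : (0 : ℝ) < N := by exact_mod_cast hN
  have H : ∀ k : ℕ, ∃ a b : ℝ, k < N →
      ∀ x ∈ Set.Icc ((k : ℝ) / (N : ℝ)) (((k : ℝ) + 1) / (N : ℝ)), v x = a * x + b := by
    intro k
    by_cases hk : k < N
    · obtain ⟨a, b, h⟩ := hv.2 k hk
      exact ⟨a, b, fun _ => h⟩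
    · exact ⟨0, 0, fun h => absurd h hk⟩
  choose α β hab using H
  have hle : ∀ k : ℕ, (k : ℝ) / N ≤ ((k : ℝ) + 1) / N := fun k => by gcongr; linarith
  have hβ : β 0 = 0 := by
    have := hab 0 hN 0 ⟨by simp, by simp⟩
    rw [h0] at this
    linarith
  have hkβ : ∀ k : ℕ, (k : ℝ) / N = 0 → β k = 0 := by
    intro k hk
    have : (k : ℝ) = 0 := by
      rcases div_eq_zero_iff.1 hk with h | h
      · exact h
      · exact absurd h hN'.ne'
    have : k = 0 := by exact_mod_cast this
    rw [this, hβ]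
  have e0 : ((0 : ℕ) : ℝ) / (N : ℝ) = 0 := by simp
  have e1 : (N : ℝ) / (N : ℝ) = 1 := div_self hN'.ne'
  have W := fun k (hk : k < N) => cell_weight_int (v := v) (by positivity) (hle k) (hkβ k) (hab k hk)
  have E := fun k (hk : k < N) => cell_energy_int (v := v) (hle k) (hab k hk)
  have hW : ∀ k < N, IntervalIntegrable (fun x => (v x) ^ 2 / x ^ 2) volume
      ((fun k : ℕ => (k : ℝ) / N) k) ((fun k : ℕ => (k : ℝ) / N) (k + 1)) := by
    intro k hk
    have := (W k hk).1
    simpa using this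
  have hE : ∀ k < N, IntervalIntegrable (fun x => (deriv v x) ^ 2) volume
      ((fun k : ℕ => (k : ℝ) / N) k) ((fun k : ℕ => (k : ℝ) / N) (k + 1)) := by
    intro k hk
    have := (E k hk).1
    simpa using this
  refine ⟨α, β, hab, hβ, ?_, ?_, ?_⟩
  · have := IntervalIntegrable.trans_iterate hW
    simpa only [e0, e1] using this
  · have := intervalIntegral.sum_integral_adjacent_intervals hE
    simp only [e0, e1] at this
    rw [← this]
    apply Finset.sum_congr rfl
    intro k hk
    have := (E k (Finset.mem_range.1 hk)).2
    push_cast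
    exact this
  · have := intervalIntegral.sum_integral_adjacent_intervals hW
    simp only [e0, e1] at this
    rw [← this]
    apply Finset.sum_congr rfl
    intro k hk
    have := (W k (Finset.mem_range.1 hk)).2
    push_cast
    exact this

lemma weight_pos (v : ℝ → ℝ) (hv : ContinuousOn v (Set.Icc 0 1))
    (hi : IntervalIntegrable (fun x => (v x) ^ 2 / x ^ 2) volume 0 1)
    (h0 : v 0 = 0) (hne : ∃ x ∈ Set.Icc (0:ℝ) 1, v x ≠ 0) :
    0 < ∫ x in (0:ℝ)..1, (v x) ^ 2 / x ^ 2 := by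
  have h2 : ContinuousOn (fun x => (v x) ^ 2) (Set.Icc 0 1) := hv.pow 2
  have hpos : 0 < ∫ x in (0:ℝ)..1, (v x) ^ 2 := by
    apply intervalIntegral.integral_pos one_pos h2
    · intro x _; positivity
    · obtain ⟨x, hx, hx'⟩ := hne
      exact ⟨x, hx, by positivity⟩
  refine hpos.trans_le ?_
  apply intervalIntegral.integral_mono_on_of_le_Ioo zero_le_one _ hi
  · intro x hx
    have hx0 := hx.1
    rw [le_div_iff₀ (by positivity)]
    have : x ^ 2 ≤ 1 := by nlinarith [hx.1, hx.2]
    nlinarith [sq_nonneg (v x)]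
  · apply ContinuousOn.intervalIntegrable
    rwa [Set.uIcc_of_le zero_le_one]

lemma quot_lower (N : ℕ) (hN : 0 < N) (μ : ℝ) (hμ : 0 < μ) (hμ' : μ * (log N + 16) = π)
    (hμ1 : μ ≤ 1/8) (v : ℝ → ℝ) (hv : MemVh N v) (h0 : v 0 = 0) :
    (1/4 + μ^2) * (∫ x in (0:ℝ)..1, (v x) ^ 2 / x ^ 2) ≤ ∫ x in (0:ℝ)..1, (deriv v x) ^ 2 := by
  have hN' : (0 : ℝ) < N := by exact_mod_cast hN
  obtain ⟨α, β, hab, hβ, -, hE, hW⟩ := decomp N hN v hv h0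
  rw [hE, hW]
  set c := 8 * μ + μ * log N with hc
  have hpi := pi_gt_three
  have hs : ∀ x : ℝ, (1:ℝ) / N ≤ x → x ≤ 1 → 0 < sin (μ * log x + c) := by
    intro x h1 h2
    have hx0 : 0 < x := lt_of_lt_of_le (by positivity) h1
    have a1 : log (1 / N) ≤ log x := log_le_log (by positivity) h1
    have a2 : log x ≤ 0 := log_nonpos hx0.le h2
    rw [one_div, log_inv] at a1
    apply sin_pos_of_pos_of_lt_pi <;> nlinarith
  have hcot : μ * (cos (8 * μ) / sin (8 * μ)) ≤ 1/8 := by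
    have hs8 : 0 < sin (8 * μ) := sin_pos_of_pos_of_lt_pi (by linarith) (by linarith)
    have hc8 : 0 < cos (8 * μ) := cos_pos_of_mem_Ioo ⟨by linarith, by linarith⟩
    have := le_tan (x := 8 * μ) (by linarith) (by linarith)
    rw [tan_eq_sin_div_cos, le_div_iff₀ hc8] at this
    rw [← mul_div_assoc, div_le_iff₀ hs8]
    linarith
  have hgN : 0 ≤ gg μ c 1 := by
    have : μ * log 1 + c = π - 8 * μ := by rw [log_one, hc]; linarith
    unfold gg
    rw [this, cos_pi_sub, sin_pi_sub, neg_div]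
    apply div_nonneg _ zero_le_one
    linarith
  have hgh : gg μ c (1 / N) ≤ (5/8) * N := by
    have : μ * log (1 / N) + c = 8 * μ := by rw [one_div, log_inv, hc]; ring
    unfold gg
    rw [this, div_div_eq_mul_div, div_one]
    apply mul_le_mul_of_nonneg_right _ hN'.le
    linarith
  let G : ℕ → ℝ := fun k => if k = 0 then 0 else gg μ c ((k : ℝ) / N) * (v ((k : ℝ) / N)) ^ 2
  have step : ∀ k < N, G (k + 1) - G k + (1/4 + μ^2) * (∫ x in ((k : ℝ) / N)..(((k : ℝ) + 1) / N),
            (α k * x + β k) ^ 2 / x ^ 2) ≤ α k ^ 2 * (((k : ℝ) + 1) / N - (k : ℝ) / N) := by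
    intro k hk
    have hle : (k : ℝ) / N ≤ ((k : ℝ) + 1) / N := by gcongr; linarith
    have v2 := hab k hk (((k : ℝ) + 1) / N) ⟨hle, le_rfl⟩
    have v1 := hab k hk ((k : ℝ) / N) ⟨le_rfl, hle⟩
    rcases Nat.eq_zero_or_pos k with rfl | hkpos
    · have ei : (∫ x in (((0:ℕ) : ℝ) / N)..((((0:ℕ) : ℝ) + 1) / N), (α 0 * x + β 0) ^ 2 / x ^ 2)
          = α 0 ^ 2 * (1 / N) := by
        rw [hβ]
        have : Set.EqOn (fun x : ℝ => (α 0 * x + 0) ^ 2 / x ^ 2) (fun _ => α 0 ^ 2)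
            (Set.uIoo (((0:ℕ) : ℝ) / N) ((((0:ℕ) : ℝ) + 1) / N)) := by
          rw [Set.uIoo_of_le hle]
          intro x hx
          have : 0 < x := by simpa using hx.1
          simp only
          field_simp
          ring
        rw [intervalIntegral.integral_congr_uIoo this]
        simp [mul_comm]
      rw [ei]
      simp only [G]
      push_cast
      simp only [Nat.cast_zero, zero_add, hβ, add_zero] at v2
      simp only [zero_add, v2, zero_div, sub_zero]
      have : gg μ c (1 / N) * (α 0 * (1 / N)) ^ 2 ≤ (5/8) * N * (α 0 * (1 / N)) ^ 2 :=
        mul_le_mul_of_nonneg_right hgh (sq_nonneg _)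
      have e : (5/8) * N * (α 0 * (1 / (N:ℝ))) ^ 2 = (5/8) * (α 0 ^ 2 * (1 / N)) := by
        field_simp
      have hp : 0 ≤ α 0 ^ 2 * (1 / (N:ℝ)) := by positivity
      have : (1/4 + μ^2) * (α 0 ^ 2 * (1 / (N:ℝ))) ≤ (3/8) * (α 0 ^ 2 * (1 / (N:ℝ))) := by
        apply mul_le_mul_of_nonneg_right _ hp
        nlinarith
      linarith
    · have hk1 : (1:ℝ) ≤ k := by exact_mod_cast hkpos
      have hkN : (k:ℝ) + 1 ≤ N := by exact_mod_cast hk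
      have := cell_lower μ c (α k) (β k) ((k : ℝ) / N) (((k : ℝ) + 1) / N) (by positivity) hle (by
        intro x hx
        apply hs
        · refine le_trans ?_ hx.1
          gcongr
        · refine hx.2.trans ?_
          rw [div_le_one hN']
          exact hkN)
      simp only [G]
      push_cast
      rw [if_neg (by omega), v1, v2]
      exact this
  have hsum := Finset.sum_le_sum (fun k hk => step k (Finset.mem_range.1 hk))
  rw [Finset.sum_add_distrib, Finset.sum_range_sub, ← Finset.mul_sum] at hsum
  have hG0 : G 0 = 0 := by simp [G]
  have hGN : 0 ≤ G N := by
    simp only [G]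
    rw [if_neg hN.ne', div_self hN'.ne']
    positivity
  linarith

lemma Sdisc_lower (N : ℕ) (hN : 0 < N) (μ : ℝ) (hμ : 0 < μ) (hμ' : μ * (log N + 16) = π)
    (hμ1 : μ ≤ 1/8) : 1/4 + μ^2 ≤ Sdisc N := by
  apply le_csInf
  · refine ⟨_, fun x => x, ⟨continuousOn_id, fun k _ => ⟨1, 0, fun x _ => by ring⟩⟩, rfl,
      ⟨1, by simp, one_ne_zero⟩, rfl⟩
  · rintro s ⟨v, hv, h0, hne, rfl⟩
    obtain ⟨_, _, _, _, hi, -⟩ := decomp N hN v hv h0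
    rw [le_div_iff₀ (weight_pos v hv.1 hi h0 hne)]
    exact quot_lower N hN μ hμ hμ' hμ1 v hv h0

def hat (t : ℝ) : ℝ := max 0 (1 - |t|)

def interp (N : ℕ) (u : ℕ → ℝ) (x : ℝ) : ℝ :=
  ∑ k ∈ Finset.range (N + 1), u k * hat (N * x - k)

lemma interp_eq (N : ℕ) (hN : 0 < N) (u : ℕ → ℝ) (j : ℕ) (hj : j < N) (x : ℝ)
    (hx : x ∈ Set.Icc ((j : ℝ) / N) (((j : ℝ) + 1) / N)) :
    interp N u x = u j * (1 - (N * x - j)) + u (j + 1) * (N * x - j) := by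
  have hN' : (0 : ℝ) < N := by exact_mod_cast hN
  have h1 : (j : ℝ) ≤ N * x := by
    have := hx.1
    rw [div_le_iff₀ hN'] at this
    linarith
  have h2 : (N : ℝ) * x ≤ j + 1 := by
    have := hx.2
    rw [le_div_iff₀ hN'] at this
    linarith
  unfold interp
  rw [Finset.sum_eq_add (a := j) (b := j + 1) (by omega)]
  · have e1 : hat (N * x - j) = 1 - (N * x - j) := by
      unfold hat
      rw [abs_of_nonneg (by linarith), max_eq_right (by linarith)]
    have e2 : hat (N * x - ((j + 1 : ℕ) : ℝ)) = N * x - j := by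
      unfold hat
      push_cast
      rw [abs_of_nonpos (by linarith), max_eq_right (by linarith)]
      ring
    rw [e1, e2]
  · rintro k _ ⟨hk1, hk2⟩
    have : hat (N * x - k) = 0 := by
      unfold hat
      apply max_eq_left
      have : 1 ≤ |(N : ℝ) * x - k| := by
        rcases lt_or_gt_of_ne hk1 with h | h
        · have : (k : ℝ) + 1 ≤ j := by exact_mod_cast h
          rw [abs_of_nonneg (by linarith)]
          linarith
        · have : j + 2 ≤ k := by omega
          have : (j : ℝ) + 2 ≤ k := by exact_mod_cast this
          rw [abs_of_nonpos (by linarith)]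
          linarith
      linarith
    rw [this, mul_zero]
  · intro h; exact absurd (Finset.mem_range.2 (by omega)) h
  · intro h; exact absurd (Finset.mem_range.2 (by omega)) h

lemma interp_mem (N : ℕ) (hN : 0 < N) (u : ℕ → ℝ) : MemVh N (interp N u) := by
  constructor
  · apply Continuous.continuousOn
    unfold interp hat
    fun_prop
  · intro k hk
    refine ⟨N * (u (k + 1) - u k), u k * (1 + k) - u (k + 1) * k, fun x hx => ?_⟩
    rw [interp_eq N hN u k hk x hx]
    ring

def UU (μ c x : ℝ) : ℝ := √x * sin (μ * log x + c)

def PP (μ c x : ℝ) : ℝ :=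
  (1/4 + μ^2) * (log x / 2) + (sin (μ * log x + c))^2 / 2
    + (μ / 2 - 1 / (8 * μ)) * (sin (μ * log x + c) * cos (μ * log x + c))

def RR (μ c h x : ℝ) : ℝ :=
  log x / 2 - sin (μ * log x + c) * cos (μ * log x + c) / (2 * μ) + 4 * h * x⁻¹

def UD (μ c x : ℝ) : ℝ := (sin (μ * log x + c) / 2 + μ * cos (μ * log x + c)) / √x

lemma theta_deriv (μ c x : ℝ) (hx : 0 < x) :
    HasDerivAt (fun x => μ * log x + c) (μ * x⁻¹) x :=
  ((hasDerivAt_log hx.ne').const_mul μ).add_const c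

lemma UU_deriv (μ c x : ℝ) (hx : 0 < x) : HasDerivAt (UU μ c) (UD μ c x) x := by
  have h := (hasDerivAt_sqrt hx.ne').fun_mul (theta_deriv μ c x hx).sin
  unfold UU
  convert! h using 1
  unfold UD
  have hs : 0 < √x := sqrt_pos.2 hx
  have e : x⁻¹ = 1 / (√x * √x) := by rw [mul_self_sqrt hx.le, one_div]
  rw [e]
  field_simp

lemma PP_deriv (μ c x : ℝ) (hμ : 0 < μ) (hx : 0 < x) :
    HasDerivAt (PP μ c) ((UD μ c x) ^ 2) x := by
  have ht := theta_deriv μ c x hx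
  have h := ((((hasDerivAt_log hx.ne').div_const 2).const_mul (1/4 + μ^2)).fun_add
    ((ht.sin.fun_pow 2).div_const 2)).fun_add
    ((ht.sin.fun_mul ht.cos).const_mul (μ / 2 - 1 / (8 * μ)))
  unfold PP
  convert! h using 1
  unfold UD
  rw [div_pow, sq_sqrt hx.le]
  have e := sin_sq_add_cos_sq (μ * log x + c)
  set S := sin (μ * log x + c)
  set C := cos (μ * log x + c)
  have hC : C ^ 2 = 1 - S ^ 2 := by linarith
  field_simp
  ring_nf
  try rw [hC]
  try ring

lemma RR_deriv (μ c h x : ℝ) (hμ : 0 < μ) (hx : 0 < x) :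
    HasDerivAt (RR μ c h) ((UU μ c x) ^ 2 / x ^ 2 - 4 * h / x ^ 2) x := by
  have ht := theta_deriv μ c x hx
  have h := (((hasDerivAt_log hx.ne').div_const 2).fun_sub
    ((ht.sin.fun_mul ht.cos).div_const (2 * μ))).fun_add
    ((hasDerivAt_inv hx.ne').const_mul (4 * h))
  unfold RR
  convert! h using 1
  unfold UU
  rw [mul_pow, sq_sqrt hx.le]
  have e := sin_sq_add_cos_sq (μ * log x + c)
  set S := sin (μ * log x + c)
  set C := cos (μ * log x + c)
  have hC : C ^ 2 = 1 - S ^ 2 := by linarith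
  field_simp
  ring_nf
  try rw [hC]
  try ring

lemma cell_E (μ c α β p q : ℝ) (hμ : 0 < μ) (hp : 0 < p) (hpq : p < q)
    (h1 : α * p + β = UU μ c p) (h2 : α * q + β = UU μ c q) :
    α ^ 2 * (q - p) ≤ PP μ c q - PP μ c p := by
  have hd : ∀ x ∈ Set.Icc p q, HasDerivAt (fun x => PP μ c x - 2 * α * UU μ c x + α ^ 2 * x)
      ((UD μ c x) ^ 2 - 2 * α * UD μ c x + α ^ 2 * 1) x := by
    intro x hx
    have hx0 : 0 < x := lt_of_lt_of_le hp hx.1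
    exact ((PP_deriv μ c x hμ hx0).fun_sub ((UU_deriv μ c x hx0).const_mul (2 * α))).fun_add
      ((hasDerivAt_id x).const_mul (α ^ 2))
  have hm : MonotoneOn (fun x => PP μ c x - 2 * α * UU μ c x + α ^ 2 * x) (Set.Icc p q) := by
    apply monotoneOn_of_deriv_nonneg (convex_Icc p q)
    · exact fun x hx => (hd x hx).continuousAt.continuousWithinAt
    · intro x hx
      exact (hd x (interior_subset hx)).differentiableAt.differentiableWithinAt
    · intro x hx
      rw [(hd x (interior_subset hx)).deriv]
      nlinarith [sq_nonneg (UD μ c x - α)]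
  have := hm ⟨le_rfl, hpq.le⟩ ⟨hpq.le, le_rfl⟩ hpq.le
  simp only [← h1, ← h2] at this
  nlinarith

lemma cell_W (μ c α β p q h : ℝ) (hμ : 0 < μ) (hμ2 : μ ≤ 1/2) (hp : 0 < p) (hpq : p < q)
    (hq : q ≤ 4 * p) (hh : q - p = h)
    (h1 : α * p + β = UU μ c p) (h2 : α * q + β = UU μ c q) :
    RR μ c h q - RR μ c h p ≤ ∫ x in p..q, (α * x + β) ^ 2 / x ^ 2 := by
  have hc : ContinuousOn (fun x => (α * x + β) ^ 2 / x ^ 2) (Set.Icc p q) := by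
    apply ContinuousOn.div (by fun_prop) (by fun_prop)
    intro x hx
    have : 0 < x := lt_of_lt_of_le hp hx.1
    positivity
  have hsp : 0 < √p := sqrt_pos.2 hp
  have hh0 : 0 < h := by linarith
  have hUD : ∀ x ∈ Set.Icc p q, ‖UD μ c x‖ ≤ 1 / √p := by
    intro x hx
    have hx0 : 0 < x := lt_of_lt_of_le hp hx.1
    have hsx : √p ≤ √x := sqrt_le_sqrt hx.1
    unfold UD
    rw [norm_div, Real.norm_eq_abs, Real.norm_eq_abs, abs_of_nonneg (sqrt_nonneg x)]
    apply div_le_div₀ zero_le_one _ hsp hsx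
    have a1 := neg_one_le_sin (μ * log x + c)
    have a2 := sin_le_one (μ * log x + c)
    have a3 := neg_one_le_cos (μ * log x + c)
    have a4 := cos_le_one (μ * log x + c)
    rw [abs_le]
    constructor <;> nlinarith
  have hlip : ∀ x ∈ Set.Icc p q, ∀ y ∈ Set.Icc p q, |UU μ c y - UU μ c x| ≤ h / √p := by
    intro x hx y hy
    have := (convex_Icc p q).norm_image_sub_le_of_norm_hasDerivWithin_le
      (f := UU μ c) (f' := UD μ c) (C := 1 / √p)
      (fun z hz => (UU_deriv μ c z (lt_of_lt_of_le hp hz.1)).hasDerivWithinAt) hUD hx hy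
    rw [Real.norm_eq_abs, Real.norm_eq_abs] at this
    refine this.trans ?_
    have hxy : |y - x| ≤ h := by
      rw [abs_le]
      constructor <;> linarith [hx.1, hx.2, hy.1, hy.2]
    calc 1 / √p * |y - x| ≤ 1 / √p * h := by gcongr
      _ = h / √p := by ring
  refine intervalIntegral.sub_le_integral_of_hasDeriv_right_of_le
    (g' := fun x => (UU μ c x) ^ 2 / x ^ 2 - 4 * h / x ^ 2) hpq.le
    (fun x hx => (RR_deriv μ c h x hμ (lt_of_lt_of_le hp hx.1)).continuousAt.continuousWithinAt)
    (fun x hx => (RR_deriv μ c h x hμ (lt_trans hp hx.1)).hasDerivWithinAt)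
    hc.integrableOn_Icc ?_
  intro x hx
  have hx0 : 0 < x := lt_trans hp hx.1
  have hxI : x ∈ Set.Icc p q := ⟨hx.1.le, hx.2.le⟩
  have b1 := hlip x hxI p ⟨le_rfl, hpq.le⟩
  have b2 := hlip x hxI q ⟨hpq.le, le_rfl⟩
  rw [← sub_div]
  apply div_le_div_of_nonneg_right _ (by positivity)
  have e : h * (α * x + β - UU μ c x)
      = (UU μ c p - UU μ c x) * (q - x) + (UU μ c q - UU μ c x) * (x - p) := by
    rw [← h1, ← h2, ← hh]; ring
  have hdiff : |α * x + β - UU μ c x| ≤ h / √p := by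
    have hle : |h * (α * x + β - UU μ c x)| ≤ h * (h / √p) := by
      rw [e]
      calc _ ≤ |(UU μ c p - UU μ c x) * (q - x)| + |(UU μ c q - UU μ c x) * (x - p)| := abs_add_le _ _
        _ = |UU μ c p - UU μ c x| * (q - x) + |UU μ c q - UU μ c x| * (x - p) := by
            rw [abs_mul, abs_mul, abs_of_nonneg (sub_nonneg.2 hx.2.le),
              abs_of_nonneg (sub_nonneg.2 hx.1.le)]
        _ ≤ (h / √p) * (q - x) + (h / √p) * (x - p) := by
            have := hx.1
            have := hx.2
            gcongr <;> linarith
        _ = h * (h / √p) := by rw [← hh]; ring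
    rw [abs_mul, abs_of_pos hh0] at hle
    exact le_of_mul_le_mul_left hle hh0
  have hU : |UU μ c x| ≤ 2 * √p := by
    unfold UU
    rw [abs_mul, abs_of_nonneg (sqrt_nonneg x)]
    have : √x ≤ 2 * √p := by
      rw [sqrt_le_left (by positivity), mul_pow, sq_sqrt hp.le]
      linarith [hx.2]
    calc √x * |sin (μ * log x + c)| ≤ √x * 1 := by
          gcongr
          exact abs_sin_le_one _
      _ ≤ _ := by linarith
  have hprod : |UU μ c x * (α * x + β - UU μ c x)| ≤ 2 * h := by
    rw [abs_mul]
    calc _ ≤ (2 * √p) * (h / √p) := by gcongr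
      _ = 2 * h := by field_simp
  have := (abs_le.1 hprod).1
  nlinarith [sq_nonneg (α * x + β - UU μ c x)]

lemma Sdisc_upper (N m : ℕ) (hm : 0 < m) (hmN : m < N) (l μ : ℝ) (hl : l = log N - log m)
    (hμ : μ * l = π) (hμ0 : 0 < μ) (hμ2 : μ ≤ 1/2) (hpos : 0 < l / 2 - 4 / m) :
    Sdisc N ≤ (1/4 + μ^2) * (l / 2) / (l / 2 - 4 / m) := by
  have hN : 0 < N := by omega
  have hN' : (0 : ℝ) < N := by exact_mod_cast hN
  have hm' : (0 : ℝ) < m := by exact_mod_cast hm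
  set c := μ * l with hc
  have hθa : μ * log ((m : ℝ) / N) + c = 0 := by
    rw [log_div hm'.ne' hN'.ne', hc, hl]; ring
  have hθ1 : μ * log 1 + c = π := by rw [log_one, hμ]; ring
  let u : ℕ → ℝ := fun k => UU μ c (((max k m : ℕ) : ℝ) / N)
  have hu0 : ∀ k ≤ m, u k = 0 := by
    intro k hk
    simp only [u]
    rw [max_eq_right hk]
    unfold UU
    rw [hθa, sin_zero, mul_zero]
  set v := interp N u with hv
  have hmem : MemVh N v := interp_mem N hN u
  have hnode1 : ∀ k < N, v ((k : ℝ) / N) = u k := by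
    intro k hk
    rw [hv, interp_eq N hN u k hk _ ⟨le_rfl, by gcongr; linarith⟩]
    field_simp
    ring
  have hnode2 : ∀ k < N, v (((k : ℝ) + 1) / N) = u (k + 1) := by
    intro k hk
    rw [hv, interp_eq N hN u k hk _ ⟨by gcongr; linarith, le_rfl⟩]
    field_simp
    ring
  have h0 : v 0 = 0 := by
    have := hnode1 0 hN
    simp only [Nat.cast_zero, zero_div] at this
    rw [this, hu0 0 (by omega)]
  obtain ⟨α, β, hab, hβ, hi, hE, hW⟩ := decomp N hN v hmem h0
  have hcell : ∀ k < N, α k * ((k : ℝ) / N) + β k = u k ∧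
      α k * (((k : ℝ) + 1) / N) + β k = u (k + 1) := by
    intro k hk
    have hle : (k : ℝ) / N ≤ ((k : ℝ) + 1) / N := by gcongr; linarith
    exact ⟨by rw [← hab k hk _ ⟨le_rfl, hle⟩, hnode1 k hk],
      by rw [← hab k hk _ ⟨hle, le_rfl⟩, hnode2 k hk]⟩
  have hEk : ∀ k < N, α k ^ 2 * (((k : ℝ) + 1) / N - (k : ℝ) / N) ≤
      PP μ c (((max (k + 1) m : ℕ) : ℝ) / N) - PP μ c (((max k m : ℕ) : ℝ) / N) := by
    intro k hk
    obtain ⟨e1, e2⟩ := hcell k hk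
    have hlt : (k : ℝ) / N < ((k : ℝ) + 1) / N := by gcongr; linarith
    rcases Nat.lt_or_ge k m with hkm | hkm
    · rw [hu0 k hkm.le] at e1
      rw [hu0 (k + 1) hkm] at e2
      rw [max_eq_right hkm.le, max_eq_right (show k + 1 ≤ m from hkm)]
      have : α k * (((k : ℝ) + 1) / N - (k : ℝ) / N) = 0 := by linarith
      have : α k ^ 2 * (((k : ℝ) + 1) / N - (k : ℝ) / N) = 0 := by
        rw [pow_two, mul_assoc, this, mul_zero]
      linarith
    · simp only [u] at e1 e2
      rw [max_eq_left hkm] at e1 ⊢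
      rw [max_eq_left (show m ≤ k + 1 by omega)] at e2 ⊢
      push_cast at e2 ⊢
      have hk0 : (0:ℝ) < k := by exact_mod_cast (by omega : 0 < k)
      exact cell_E μ c (α k) (β k) _ _ hμ0 (by positivity) hlt e1 e2
  have hWk : ∀ k < N, RR μ c (1 / N) (((max (k + 1) m : ℕ) : ℝ) / N)
      - RR μ c (1 / N) (((max k m : ℕ) : ℝ) / N) ≤
      ∫ x in ((k : ℝ) / N)..(((k : ℝ) + 1) / N), (α k * x + β k) ^ 2 / x ^ 2 := by
    intro k hk
    obtain ⟨e1, e2⟩ := hcell k hk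
    have hlt : (k : ℝ) / N < ((k : ℝ) + 1) / N := by gcongr; linarith
    rcases Nat.lt_or_ge k m with hkm | hkm
    · rw [max_eq_right hkm.le, max_eq_right (show k + 1 ≤ m from hkm), sub_self]
      apply intervalIntegral.integral_nonneg hlt.le
      intro x _
      positivity
    · simp only [u] at e1 e2
      rw [max_eq_left hkm] at e1 ⊢
      rw [max_eq_left (show m ≤ k + 1 by omega)] at e2 ⊢
      push_cast at e2 ⊢
      have hk0 : (1:ℝ) ≤ k := by exact_mod_cast (by omega : 1 ≤ k)
      refine cell_W μ c (α k) (β k) _ _ _ hμ0 hμ2 (by positivity) hlt ?_ (by ring) e1 e2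
      rw [← mul_div_assoc]
      gcongr
      linarith
  have hsE := Finset.sum_le_sum (fun k hk => hEk k (Finset.mem_range.1 hk))
  have hsW := Finset.sum_le_sum (fun k hk => hWk k (Finset.mem_range.1 hk))
  rw [← hE, Finset.sum_range_sub (fun k : ℕ => PP μ c (((max k m : ℕ) : ℝ) / N))] at hsE
  rw [← hW, Finset.sum_range_sub (fun k : ℕ => RR μ c (1 / N) (((max k m : ℕ) : ℝ) / N))] at hsW
  rw [max_eq_left hmN.le, max_eq_right (Nat.zero_le m), div_self hN'.ne'] at hsE hsW
  have hloga : log ((m : ℝ) / N) = - l := by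
    rw [log_div hm'.ne' hN'.ne', hl]; ring
  have hE' : (∫ x in (0:ℝ)..1, (deriv v x) ^ 2) ≤ (1/4 + μ^2) * (l / 2) := by
    refine hsE.trans (le_of_eq ?_)
    unfold PP
    rw [hθa, hθ1, sin_pi, sin_zero, hloga, log_one]
    ring
  have hW' : l / 2 - 4 / m ≤ ∫ x in (0:ℝ)..1, (v x) ^ 2 / x ^ 2 := by
    refine le_trans ?_ hsW
    unfold RR
    rw [hθa, hθ1, sin_pi, sin_zero, hloga, log_one]
    have : 4 * (1 / (N : ℝ)) * ((m : ℝ) / N)⁻¹ = 4 / m := by field_simp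
    rw [this]
    have : 0 ≤ 4 * (1 / (N : ℝ)) * 1⁻¹ := by positivity
    simp only [zero_mul, zero_div, sub_zero]
    linarith
  have hne : ∃ x ∈ Set.Icc (0:ℝ) 1, v x ≠ 0 := by
    by_contra! hcon
    have : (∫ x in (0:ℝ)..1, (v x) ^ 2 / x ^ 2) = ∫ x in (0:ℝ)..1, (0:ℝ) := by
      apply intervalIntegral.integral_congr
      rw [Set.uIcc_of_le zero_le_one]
      intro x hx
      simp [hcon x hx]
    rw [this, intervalIntegral.integral_zero] at hW'
    linarith
  have hS : Sdisc N ≤ (∫ x in (0:ℝ)..1, (deriv v x) ^ 2) / (∫ x in (0:ℝ)..1, (v x) ^ 2 / x ^ 2) := by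
    apply csInf_le
    · refine ⟨0, ?_⟩
      rintro s ⟨w, -, -, -, rfl⟩
      apply div_nonneg <;> apply intervalIntegral.integral_nonneg zero_le_one <;> intro x _ <;>
        positivity
    · exact ⟨v, hmem, h0, hne, rfl⟩
  refine hS.trans ?_
  have hl0 : 0 ≤ l := by
    have : (0:ℝ) ≤ 4 / m := by positivity
    linarith
  apply div_le_div₀ (by positivity) hE' hpos hW'

def mm (y : ℝ) : ℕ := ⌈y ^ 2⌉₊

def ll (y : ℝ) : ℝ := y - log (mm y)

lemma ll_div : Tendsto (fun y : ℝ => ll y / y) atTop (nhds 1) := by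
  have h0 : Tendsto (fun y : ℝ => log (mm y) / y) atTop (nhds 0) := by
    have h1 := (Real.tendsto_pow_log_div_mul_add_atTop 1 (-1) 1 one_ne_zero).comp
      (tendsto_atTop_add_const_right atTop (1:ℝ) tendsto_id)
    have h2 := h1.const_mul 2
    rw [mul_zero] at h2
    refine squeeze_zero' ?_ ?_ h2
    · filter_upwards [eventually_gt_atTop 0] with y hy
      exact div_nonneg (log_natCast_nonneg _) hy.le
    · filter_upwards [eventually_gt_atTop 0] with y hy
      simp only [Function.comp, id, pow_one, one_mul, add_neg_cancel_right]
      rw [← mul_div_assoc]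
      gcongr
      have hm : (0:ℝ) < mm y := by
        have : 0 < mm y := Nat.ceil_pos.2 (by positivity)
        exact_mod_cast this
      have hm2 : (mm y : ℝ) < y ^ 2 + 1 := Nat.ceil_lt_add_one (by positivity)
      have : 2 * log (y + 1) = log ((y + 1) ^ 2) := by rw [log_pow]; norm_num
      rw [this]
      apply log_le_log hm
      nlinarith
  have := (tendsto_const_nhds (x := (1:ℝ))).sub h0
  rw [sub_zero] at this
  refine this.congr' ?_
  filter_upwards [eventually_gt_atTop 0] with y hy
  unfold ll
  field_simp

lemma ll_atTop : Tendsto ll atTop atTop := by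
  have := ll_div.pos_mul_atTop one_pos tendsto_id
  refine this.congr' ?_
  filter_upwards [eventually_gt_atTop 0] with y hy
  simp only [id]
  field_simp

lemma upper_lim : Tendsto (fun y : ℝ => (2 / ll y + π ^ 2 * ((ll y / y)⁻¹) ^ 2) / (1 - 8 / ll y))
    atTop (nhds (π ^ 2)) := by
  have h1 : Tendsto (fun y => 2 / ll y) atTop (nhds 0) := ll_atTop.const_div_atTop 2
  have h2 : Tendsto (fun y => 8 / ll y) atTop (nhds 0) := ll_atTop.const_div_atTop 8
  have h3 := ((ll_div.inv₀ one_ne_zero).pow 2).const_mul (π ^ 2)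
  have := (h1.add h3).div ((tendsto_const_nhds (x := (1:ℝ))).sub h2) (by norm_num)
  simpa [Pi.div_def] using this

lemma lower_lim : Tendsto (fun y : ℝ => (π / (y + 16)) ^ 2 * y ^ 2) atTop (nhds (π ^ 2)) := by
  have h1 : Tendsto (fun y : ℝ => 16 / (y + 16)) atTop (nhds 0) :=
    (tendsto_atTop_add_const_right atTop (16:ℝ) tendsto_id).const_div_atTop 16
  have h2 := ((((tendsto_const_nhds (x := (1:ℝ))).sub h1).const_mul π).pow 2)
  rw [sub_zero, mul_one] at h2
  refine h2.congr' ?_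
  filter_upwards [eventually_gt_atTop 0] with y hy
  field_simp
  ring

/-- `S_h = 1/4 + π²/|log h|² + o(1/|log h|²)` as `h = 1/N → 0`. -/
theorem discrete_hardy_asymptotics :
    Filter.Tendsto
      (fun N : ℕ =>
        (Sdisc N - 1/4 - π ^ 2 / (Real.log (1 / (N : ℝ))) ^ 2) * (Real.log (1 / (N : ℝ))) ^ 2)
      Filter.atTop (nhds 0) := by
  have hL : Tendsto (fun N : ℕ => log (N : ℝ)) atTop atTop :=
    tendsto_log_atTop.comp tendsto_natCast_atTop_atTop
  have hlo := (lower_lim.comp hL).sub_const (π ^ 2)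
  have hup := (upper_lim.comp hL).sub_const (π ^ 2)
  rw [sub_self] at hlo hup
  have hF : ∀ N : ℕ, 0 < log (N : ℝ) →
      (Sdisc N - 1/4 - π ^ 2 / (Real.log (1 / (N : ℝ))) ^ 2) * (Real.log (1 / (N : ℝ))) ^ 2
      = (Sdisc N - 1/4) * log (N : ℝ) ^ 2 - π ^ 2 := by
    intro N hN
    rw [one_div (N : ℝ), log_inv, neg_sq]
    field_simp
  refine tendsto_of_tendsto_of_tendsto_of_le_of_le' hlo hup ?_ ?_
  · filter_upwards [eventually_gt_atTop 0, hL.eventually_gt_atTop 0,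
      hL.eventually_gt_atTop (8 * π)] with N hN h1 h2
    rw [hF N h1]
    simp only [Function.comp]
    have hpi := pi_pos
    have := Sdisc_lower N hN (π / (log N + 16)) (by positivity) (by field_simp) (by
      rw [div_le_iff₀ (by linarith)]
      linarith)
    have : (π / (log N + 16)) ^ 2 * log (N:ℝ) ^ 2 ≤ (Sdisc N - 1/4) * log (N:ℝ) ^ 2 := by
      gcongr
      linarith
    linarith
  · filter_upwards [eventually_gt_atTop 0, hL.eventually_gt_atTop 0,
      (ll_atTop.comp hL).eventually_gt_atTop (2 * π),
      (ll_atTop.comp hL).eventually_gt_atTop 8] with N hN h1 h2 h3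
    rw [hF N h1]
    simp only [Function.comp] at h2 h3 ⊢
    have hpi := pi_pos
    have hN' : (0 : ℝ) < N := by exact_mod_cast hN
    set y := log (N : ℝ) with hy
    have hm : 0 < mm y := Nat.ceil_pos.2 (by positivity)
    have hm' : (1:ℝ) ≤ mm y := by exact_mod_cast hm
    have hm2 : y ^ 2 ≤ mm y := Nat.le_ceil _
    have hmN : mm y < N := by
      have : log (mm y : ℝ) < log (N : ℝ) := by
        unfold ll at h3
        linarith
      have := (log_lt_log_iff (by linarith) hN').1 this
      exact_mod_cast this
    have h4m : 4 / (mm y : ℝ) ≤ 4 := div_le_self (by norm_num) hm'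
    have hS := Sdisc_upper N (mm y) hm hmN (ll y) (π / ll y) rfl (by field_simp) (by positivity)
      (by rw [div_le_iff₀ (by linarith)]; linarith) (by linarith)
    set l := ll y
    set M : ℝ := (mm y : ℝ)
    have hl0 : 0 < l := by linarith
    have hd : 0 < l / 2 - 4 / M := by linarith
    have e1 : ((1/4 + (π / l)^2) * (l / 2) / (l / 2 - 4 / M) - 1/4) * y ^ 2
        = (y ^ 2 / M + (π * y) ^ 2 / (2 * l)) / (l / 2 - 4 / M) := by
      rw [div_sub' hd.ne', div_mul_eq_mul_div]
      congr 1
      field_simp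
      ring
    have e2 : (2 / l + π ^ 2 * ((l / y)⁻¹) ^ 2) / (1 - 8 / l)
        = (1 + (π * y) ^ 2 / (2 * l)) / (l / 2 - 4) := by
      have : 1 - 8 / l = (l / 2 - 4) * (2 / l) := by field_simp; ring
      rw [this, div_mul_eq_div_div_swap]
      congr 1
      field_simp
    have e3 : (y ^ 2 / M + (π * y) ^ 2 / (2 * l)) / (l / 2 - 4 / M)
        ≤ (1 + (π * y) ^ 2 / (2 * l)) / (l / 2 - 4) := by
      apply div_le_div₀ (by positivity) _ (by linarith) (by linarith)
      have : y ^ 2 / M ≤ 1 := by rwa [div_le_one (by linarith)]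
      linarith
    have : (Sdisc N - 1/4) * y ^ 2
        ≤ ((1/4 + (π / l)^2) * (l / 2) / (l / 2 - 4 / M) - 1/4) * y ^ 2 := by
      gcongr
    rw [e2]
    rw [e1] at this
    linarith
end
end

section
/- For every η > 0 there exists N₀ such that for every integer N ≥ N₀, setting h = 1/N, the discrete Hardy constant satisfies S_h ≤ 1/4 + π²/(|log h| − 3·log|log h|)² + η/(log h)². -/
open MeasureTheory Real Set Filter

noncomputable section

/-- piecewise linear interpolant -/
noncomputable def pl (N : ℕ) (f : ℕ → ℝ) (x : ℝ) : ℝ :=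
  ∑ i ∈ Finset.range N, (f (i+1) - f i) * max 0 (min 1 ((N:ℝ) * x - i))

lemma pl_cell (N : ℕ) (hN : 0 < N) (f : ℕ → ℝ) (f0 : f 0 = 0) (j : ℕ) (hj : j < N) (x : ℝ)
    (hx : x ∈ Set.Icc ((j : ℝ) / (N : ℝ)) (((j : ℝ) + 1) / (N : ℝ))) :
    pl N f x = f j + (f (j+1) - f j) * (N * x - j) := by
  have hN' : (0:ℝ) < N := by exact_mod_cast hN
  have h1 : (j:ℝ) ≤ N * x := by
    have := (div_le_iff₀ hN').1 hx.1; linarith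
  have h2 : N * x ≤ (j:ℝ) + 1 := by
    have := (le_div_iff₀ hN').1 hx.2; linarith
  have key : ∀ n : ℕ, ∑ i ∈ Finset.range n, (f (i+1) - f i) * max 0 (min 1 ((N:ℝ) * x - i))
      = if n ≤ j then f n else f j + (f (j+1) - f j) * (N * x - j) := by
    intro n
    induction n with
    | zero => simp [f0]
    | succ n ih =>
      rw [Finset.sum_range_succ, ih]
      rcases lt_trichotomy n j with h | h | h
      · have : (n:ℝ) + 1 ≤ j := by exact_mod_cast h
        rw [if_pos h.le, if_pos (by omega), min_eq_left (by linarith), max_eq_right (by norm_num)]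
        ring
      · subst h
        rw [if_pos le_rfl, if_neg (by omega), min_eq_right (by linarith),
          max_eq_right (by linarith)]
      · have : (j:ℝ) + 1 ≤ n := by exact_mod_cast h
        rw [if_neg (by omega), if_neg (by omega), max_eq_left, mul_zero, add_zero]
        exact (min_le_right _ _).trans (by linarith)
  have := key N
  rw [if_neg (by omega)] at this
  exact this

lemma pl_cont (N : ℕ) (f : ℕ → ℝ) : Continuous (pl N f) := by
  unfold pl; fun_prop

lemma pl_deriv (N : ℕ) (hN : 0 < N) (f : ℕ → ℝ) (f0 : f 0 = 0) (j : ℕ) (hj : j < N) (x : ℝ)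
    (hx : x ∈ Set.Ioo ((j : ℝ) / (N : ℝ)) (((j : ℝ) + 1) / (N : ℝ))) :
    deriv (pl N f) x = N * (f (j+1) - f j) := by
  have h : pl N f =ᶠ[nhds x] fun x => f j + (f (j+1) - f j) * (N * x - j) := by
    filter_upwards [Ioo_mem_nhds hx.1 hx.2] with y hy
    exact pl_cell N hN f f0 j hj y (Ioo_subset_Icc_self hy)
  rw [h.deriv_eq]
  have : HasDerivAt (fun x : ℝ => f j + (f (j+1) - f j) * (N * x - j))
      ((f (j+1) - f j) * (N * 1)) x :=
    ((((hasDerivAt_id x).const_mul (N:ℝ)).sub_const _).const_mul _).const_add _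
  rw [this.deriv]; ring

/-- test function -/
noncomputable def tu (w x : ℝ) : ℝ := √x * sin (w * log x)
noncomputable def tu' (w x : ℝ) : ℝ := (1/2 * sin (w * log x) + w * cos (w * log x)) / √x

lemma tu_deriv (w x : ℝ) (hx : 0 < x) : HasDerivAt (tu w) (tu' w x) x := by
  have h1 : HasDerivAt (fun x => w * log x) (w * x⁻¹) x := (hasDerivAt_log hx.ne').const_mul w
  have := (hasDerivAt_sqrt hx.ne').mul h1.sin
  refine this.congr_deriv ?_
  have hs : √x * √x = x := mul_self_sqrt hx.le
  have hp : 0 < √x := sqrt_pos.2 hx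
  have hs2 : √x ^ 2 = x := sq_sqrt hx.le
  have e : x⁻¹ = (√x * √x)⁻¹ := by rw [hs]
  unfold tu'
  rw [e]
  field_simp

lemma tu'_cont (w : ℝ) : ContinuousOn (tu' w) (Set.Ioi 0) := by
  unfold tu'
  have hl : ContinuousOn log (Set.Ioi 0) := continuousOn_log.mono (fun x hx => ne_of_gt hx)
  refine ContinuousOn.div ?_ continuous_sqrt.continuousOn (fun x hx => (sqrt_pos.2 hx).ne')
  fun_prop

lemma tu_abs (w x : ℝ) : |tu w x| ≤ √x := by
  unfold tu
  rw [abs_mul, abs_of_nonneg (sqrt_nonneg x)]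
  exact mul_le_of_le_one_right (sqrt_nonneg x) (abs_sin_le_one _)

lemma tu'_abs (w d x : ℝ) (hw : |w| ≤ 1) (hd : 0 < d) (hx : d ≤ x) : |tu' w x| ≤ 2 / √d := by
  have hp : 0 < √d := sqrt_pos.2 hd
  have hpx : √d ≤ √x := sqrt_le_sqrt hx
  unfold tu'
  rw [abs_div, abs_of_nonneg (sqrt_nonneg x)]
  refine div_le_div₀ (by norm_num) ?_ hp hpx
  refine (abs_add_le _ _).trans ?_
  rw [abs_mul, abs_mul]
  have := abs_sin_le_one (w * log x)
  have := abs_cos_le_one (w * log x)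
  have : |(1/2:ℝ)| = 1/2 := by norm_num
  rw [this]
  nlinarith [abs_nonneg w, abs_nonneg (cos (w * log x))]

lemma tu_lip (w d x y : ℝ) (hw : |w| ≤ 1) (hd : 0 < d) (hx : d ≤ x) (hy : d ≤ y) :
    |tu w y - tu w x| ≤ 2 / √d * |y - x| :=
  Convex.norm_image_sub_le_of_norm_hasDerivWithin_le (s := Set.Ici d) (f' := tu' w)
    (fun z hz => (tu_deriv w z (hd.trans_le hz)).hasDerivWithinAt)
    (fun z hz => tu'_abs w d z hw hd hz) (convex_Ici d) hx hy

lemma uIcc_pos {a b x : ℝ} (ha : 0 < a) (hab : a ≤ b) (hx : x ∈ Set.uIcc a b) : 0 < x := by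
  rw [uIcc_of_le hab] at hx; exact ha.trans_le hx.1

lemma tu'_sq_int (w a b : ℝ) (ha : 0 < a) (hab : a ≤ b) :
    IntervalIntegrable (fun x => tu' w x ^ 2) volume a b :=
  (((tu'_cont w).mono (fun x hx => uIcc_pos ha hab hx)).pow 2).intervalIntegrable

lemma cell_energy (w a b : ℝ) (ha : 0 < a) (hab : a < b) :
    (tu w b - tu w a) ^ 2 / (b - a) ≤ ∫ x in a..b, tu' w x ^ 2 := by
  have hi : IntervalIntegrable (tu' w) volume a b :=
    ((tu'_cont w).mono (fun x hx => uIcc_pos ha hab.le hx)).intervalIntegrable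
  have h1 : ∫ x in a..b, tu' w x = tu w b - tu w a :=
    intervalIntegral.integral_eq_sub_of_hasDerivAt
      (fun x hx => tu_deriv w x (uIcc_pos ha hab.le hx)) hi
  set c := (tu w b - tu w a) / (b - a) with hc
  have h2 : ∫ x in a..b, (2 * c * tu' w x - c ^ 2) ≤ ∫ x in a..b, tu' w x ^ 2 := by
    refine intervalIntegral.integral_mono_on hab.le ((hi.const_mul _).sub (by simp))
      (tu'_sq_int w a b ha hab.le) (fun x _ => ?_)
    nlinarith [sq_nonneg (tu' w x - c)]
  rw [intervalIntegral.integral_sub (hi.const_mul _) (by simp),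
    intervalIntegral.integral_const_mul, h1, intervalIntegral.integral_const, smul_eq_mul] at h2
  refine le_trans (le_of_eq ?_) h2
  have : b - a ≠ 0 := by linarith
  rw [hc]; field_simp; ring

lemma tot_energy (L d : ℝ) (hL : 0 < L) (hd : 0 < d) (hd1 : d ≤ 1) (hlog : log d = -L) :
    ∫ x in d..1, tu' (π / L) x ^ 2 = L / 8 + π ^ 2 / (2 * L) := by
  set w := π / L with hw
  have hwp : 0 < w := div_pos pi_pos hL
  have hwL : w * -L = -π := by rw [hw]; field_simp
  have hder : ∀ x ∈ Set.uIcc d 1, HasDerivAt (fun x => (1/4) * ((w * log x - sin (w * log x) * cos (w * log x)) / (2 * w))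
      + sin (w * log x) ^ 2 / 2 + w ^ 2 * ((w * log x + sin (w * log x) * cos (w * log x)) / (2 * w))) (tu' w x ^ 2) x := by
    intro x hx
    have hx0 := uIcc_pos hd hd1 hx
    have h1 : HasDerivAt (fun x => w * log x) (w * x⁻¹) x := (hasDerivAt_log hx0.ne').const_mul w
    have h2 := h1.sin.mul h1.cos
    have := ((((h1.sub h2).div_const (2*w)).const_mul (1/4)).add ((h1.sin.pow 2).div_const 2)).add
      (((h1.add h2).div_const (2*w)).const_mul (w^2))
    refine this.congr_deriv ?_
    unfold tu'
    rw [div_pow _ (√x), sq_sqrt hx0.le]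
    have sc := sin_sq_add_cos_sq (w * log x)
    have : (1:ℝ) = sin (w * log x) ^2 + cos (w * log x)^2 := sc.symm
    set s := sin (w * log x)
    set c := cos (w * log x)
    field_simp
    have hc : c ^ 2 = 1 - s ^ 2 := by linarith
    simp only [Nat.cast_ofNat, hc]
    ring_nf
    try simp only [hc]
    try ring_nf
  rw [intervalIntegral.integral_eq_sub_of_hasDerivAt hder (tu'_sq_int w d 1 hd hd1)]
  rw [hlog, log_one, hwL]
  simp only [mul_zero, sin_zero, cos_zero, sin_neg, sin_pi]
  rw [hw]; field_simp; ring

lemma sq_cont (w : ℝ) : ContinuousOn (fun x => tu w x ^ 2 / x ^ 2) (Set.Ioi 0) := by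
  have : ContinuousOn (tu w) (Set.Ioi 0) :=
    fun x hx => (tu_deriv w x hx).continuousAt.continuousWithinAt
  exact (this.pow 2).div (by fun_prop) (fun x hx => pow_ne_zero 2 (ne_of_gt hx))

lemma tot_mass (L d : ℝ) (hL : 0 < L) (hd : 0 < d) (hd1 : d ≤ 1) (hlog : log d = -L) :
    ∫ x in d..1, tu (π / L) x ^ 2 / x ^ 2 = L / 2 := by
  set w := π / L with hw
  have hwp : 0 < w := div_pos pi_pos hL
  have hwL : w * -L = -π := by rw [hw]; field_simp
  have hder : ∀ x ∈ Set.uIcc d 1, HasDerivAt (fun x => (w * log x - sin (w * log x) * cos (w * log x)) / (2 * w))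
       (tu w x ^ 2 / x ^ 2) x := by
    intro x hx
    have hx0 := uIcc_pos hd hd1 hx
    have h1 : HasDerivAt (fun x => w * log x) (w * x⁻¹) x := (hasDerivAt_log hx0.ne').const_mul w
    have h2 := h1.sin.mul h1.cos
    refine ((h1.sub h2).div_const (2*w)).congr_deriv ?_
    unfold tu
    rw [mul_pow, sq_sqrt hx0.le]
    have sc := sin_sq_add_cos_sq (w * log x)
    set s := sin (w * log x)
    set c := cos (w * log x)
    field_simp
    linarith
  rw [intervalIntegral.integral_eq_sub_of_hasDerivAt hder
    ((sq_cont w).mono (fun x hx => uIcc_pos hd hd1 hx)).intervalIntegrable]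
  rw [hlog, log_one, hwL]
  simp only [mul_zero, sin_zero, cos_zero, sin_neg, sin_pi]
  rw [hw]; field_simp; ring

lemma err_cont : ContinuousOn (fun x : ℝ => √x / x ^ 2) (Set.Ioi 0) :=
  continuous_sqrt.continuousOn.div (by fun_prop) (fun x hx => pow_ne_zero 2 (ne_of_gt hx))

lemma err_int (d : ℝ) (hd : 0 < d) (hd1 : d ≤ 1) : ∫ x in d..1, √x / x ^ 2 ≤ 2 / √d := by
  have hder : ∀ x ∈ Set.uIcc d 1, HasDerivAt (fun x => -2 * (√x)⁻¹) (√x / x ^ 2) x := by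
    intro x hx
    have hx0 := uIcc_pos hd hd1 hx
    have hp : 0 < √x := sqrt_pos.2 hx0
    refine (((hasDerivAt_sqrt hx0.ne').inv hp.ne').const_mul (-2)).congr_deriv ?_
    have e : x ^ 2 = √x ^ 4 := by
      rw [show √x ^ 4 = (√x ^ 2) ^ 2 by ring, sq_sqrt hx0.le]
    rw [e]; field_simp
  rw [intervalIntegral.integral_eq_sub_of_hasDerivAt hder
    ((err_cont).mono (fun x hx => uIcc_pos hd hd1 hx)).intervalIntegrable]
  simp; rw [div_eq_mul_inv]; linarith

lemma main_bound (N k : ℕ) (hk : 0 < k) (hkN : k < N) (L : ℝ) (hL : log ((k:ℝ) / N) = -L)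
    (hpi : π ≤ L) (hpos : 8 / (k:ℝ) < L / 2) :
    Sdisc N ≤ (L / 8 + π ^ 2 / (2 * L)) / (L / 2 - 8 / k) := by
  have hL0 : 0 < L := pi_pos.trans_le hpi
  have hN : 0 < N := hk.trans hkN
  have hN' : (0:ℝ) < N := by exact_mod_cast hN
  have hk' : (0:ℝ) < k := by exact_mod_cast hk
  set d : ℝ := (k:ℝ) / N with hd_def
  have hd : 0 < d := div_pos hk' hN'
  have hd1 : d ≤ 1 := (div_le_one hN').2 (by exact_mod_cast hkN.le)
  have hw : |π / L| ≤ 1 := by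
    rw [abs_of_pos (div_pos pi_pos hL0)]; exact (div_le_one hL0).2 hpi
  set w := π / L with hw_def
  have hud : tu w d = 0 := by
    unfold tu
    rw [hL, hw_def, show π / L * -L = -π by field_simp]; simp
  set f : ℕ → ℝ := fun j => if j < k then 0 else tu w ((j:ℝ) / N) with hf
  have f0 : f 0 = 0 := by simp [hf, hk]
  have flt : ∀ j, j ≤ k → f j = 0 := by
    intro j hj
    rcases hj.lt_or_eq with h | h
    · simp [hf, h]
    · subst h; simp only [hf, lt_irrefl, if_false]; exact hud
  have fge : ∀ j, k ≤ j → f j = tu w ((j:ℝ) / N) := by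
    intro j hj; simp [hf, Nat.not_lt.2 hj]
  set v := pl N f with hv
  have vcont : Continuous v := pl_cont N f
  have vcell := pl_cell N hN f f0
  -- locating the cell
  have loc : ∀ x : ℝ, 0 ≤ x → x < 1 → ∃ j : ℕ, j < N ∧
      x ∈ Set.Icc ((j : ℝ) / (N : ℝ)) (((j : ℝ) + 1) / (N : ℝ)) ∧ x < ((j : ℝ) + 1) / N := by
    intro x h0 h1
    have hnx : 0 ≤ N * x := by positivity
    have e1 := Nat.floor_le hnx
    have e2 := Nat.lt_floor_add_one (N * x)
    refine ⟨⌊N * x⌋₊, ?_, ⟨?_, ?_⟩, ?_⟩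
    · rw [Nat.floor_lt hnx]; nlinarith
    · rw [div_le_iff₀ hN']; linarith
    · rw [le_div_iff₀ hN']; linarith
    · rw [lt_div_iff₀ hN']; linarith
  have node_mono : ∀ j : ℕ, (j:ℝ) / N ≤ ((j:ℝ) + 1) / N := fun j => by gcongr; linarith
  have vzero : ∀ x : ℝ, 0 ≤ x → x < d → v x = 0 := by
    intro x h0 h1
    obtain ⟨j, hj, hx, -⟩ := loc x h0 (h1.trans_le hd1)
    have hjk : j < k := by
      have := hx.1.trans_lt h1
      rw [hd_def, div_lt_div_iff_of_pos_right hN'] at this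
      exact_mod_cast this
    rw [hv, vcell j hj x hx, flt j hjk.le, flt (j+1) hjk]; simp
  have vclose : ∀ x : ℝ, d ≤ x → x < 1 → |tu w x - v x| ≤ 2 / √d / N := by
    intro x h0 h1
    obtain ⟨j, hj, hx, hx2⟩ := loc x (hd.le.trans h0) h1
    have hjk : k ≤ j := by
      have := h0.trans_lt hx2
      rw [hd_def, div_lt_div_iff_of_pos_right hN'] at this
      have : k < j + 1 := by exact_mod_cast this
      omega
    have hdj : d ≤ (j:ℝ) / N := by rw [hd_def]; gcongr
    have a1 : (j:ℝ) ≤ N * x := by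
      have := (div_le_iff₀ hN').1 hx.1; linarith
    have a2 : N * x ≤ (j:ℝ) + 1 := by
      have := (le_div_iff₀ hN').1 hx.2; linarith
    rw [hv, vcell j hj x hx, fge j hjk, fge (j+1) (by omega)]
    have hs := sqrt_pos.2 hd
    have hM : 0 ≤ 2 / √d := by positivity
    have b1 := tu_lip w d ((j:ℝ)/N) x hw hd hdj h0
    have b2 := tu_lip w d (((j+1:ℕ):ℝ)/N) x hw hd (by push_cast; exact hdj.trans (node_mono j)) h0
    have hn : ((j:ℝ) + 1) / N = (j:ℝ)/N + 1 / N := by rw [add_div]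
    have c1 : |x - (j:ℝ)/N| ≤ 1 / N := by
      rw [abs_le]; have h3 := hx.1; have h4 := hx.2; rw [hn] at h4
      have : 0 < 1 / (N:ℝ) := by positivity
      constructor <;> linarith
    have c2 : |x - ((j+1:ℕ):ℝ)/N| ≤ 1 / N := by
      push_cast
      rw [abs_le]; have h3 := hx.1; have h4 := hx.2; rw [hn] at h4 ⊢
      have : 0 < 1 / (N:ℝ) := by positivity
      constructor <;> linarith
    have e1 : |tu w x - tu w ((j:ℝ)/N)| ≤ 2 / √d / N :=
      b1.trans ((mul_le_mul_of_nonneg_left c1 hM).trans (le_of_eq (by ring)))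
    have e2 : |tu w x - tu w (((j+1:ℕ):ℝ)/N)| ≤ 2 / √d / N :=
      b2.trans ((mul_le_mul_of_nonneg_left c2 hM).trans (le_of_eq (by ring)))
    set t := N * x - (j:ℝ) with ht
    have t0 : 0 ≤ t := by linarith
    have t1 : t ≤ 1 := by linarith
    rw [abs_le] at e1 e2 ⊢
    obtain ⟨p1, p2⟩ := e1
    obtain ⟨q1, q2⟩ := e2
    constructor <;> nlinarith
  -- energy
  have energy : ∫ x in (0:ℝ)..1, (deriv v x) ^ 2 ≤ L / 8 + π ^ 2 / (2 * L) := by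
    have cst : ∀ j, j < N → Set.EqOn (fun x => (deriv v x) ^ 2)
        (fun _ => (N * (f (j+1) - f j)) ^ 2)
        (Set.Ioo ((j:ℝ)/N) (((j+1:ℕ):ℝ)/N)) := by
      intro j hj x hx
      push_cast at hx
      simp only [hv, pl_deriv N hN f f0 j hj x hx]
    have le' : ∀ j : ℕ, (j:ℝ)/N ≤ ((j+1:ℕ):ℝ)/N := fun j => by push_cast; exact node_mono j
    have hintg : ∀ j < N, IntervalIntegrable (fun x => (deriv v x) ^ 2) volume
        ((j:ℝ)/N) (((j+1:ℕ):ℝ)/N) := by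
      intro j hj
      have : IntervalIntegrable (fun _ : ℝ => (N * (f (j+1) - f j)) ^ 2) volume
        ((j:ℝ)/N) (((j+1:ℕ):ℝ)/N) := by simp
      refine this.congr_uIoo ?_
      rw [uIoo_of_le (le' j)]
      exact (cst j hj).symm
    have hsum := intervalIntegral.sum_integral_adjacent_intervals (μ := volume)
      (f := fun x => (deriv v x) ^ 2) (a := fun j : ℕ => (j:ℝ)/N) (n := N) hintg
    have hval : ∀ j, j < N → ∫ x in ((j:ℝ)/N)..(((j+1:ℕ):ℝ)/N), (deriv v x) ^ 2
        = N * (f (j+1) - f j) ^ 2 := by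
      intro j hj
      rw [intervalIntegral.integral_congr_Ioo_of_le (le' j) (cst j hj),
        intervalIntegral.integral_const, smul_eq_mul]
      push_cast
      field_simp
      ring
    simp only [Nat.cast_zero, zero_div, div_self hN'.ne'] at hsum
    rw [← hsum, ← tot_energy L d hL0 hd hd1 hL]
    have hsum2 := intervalIntegral.sum_integral_adjacent_intervals_Ico (μ := volume)
      (f := fun x => tu' w x ^ 2) (a := fun j : ℕ => (j:ℝ)/N) (m := k) (n := N) hkN.le
      (fun j hj => tu'_sq_int w _ _ (div_pos (hk'.trans_le (by exact_mod_cast hj.1)) hN') (le' j))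
    simp only [div_self hN'.ne'] at hsum2
    rw [← hsum2, Finset.range_eq_Ico,
      ← Finset.sum_Ico_consecutive _ (Nat.zero_le k) hkN.le]
    have z : ∑ j ∈ Finset.Ico 0 k, ∫ x in ((j:ℝ)/N)..(((j+1:ℕ):ℝ)/N), (deriv v x) ^ 2 = 0 := by
      refine Finset.sum_eq_zero fun j hj => ?_
      have hj' := (Finset.mem_Ico.1 hj).2
      rw [hval j (hj'.trans hkN), flt j hj'.le, flt (j+1) hj']; simp
    rw [z, zero_add]
    refine Finset.sum_le_sum fun j hj => ?_
    obtain ⟨h1, h2⟩ := Finset.mem_Ico.1 hj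
    rw [hval j h2, fge j h1, fge (j+1) (by omega)]
    have hj0 : 0 < (j:ℝ)/N := div_pos (hk'.trans_le (by exact_mod_cast h1)) hN'
    have hlt : (j:ℝ)/N < ((j+1:ℕ):ℝ)/N := by push_cast; gcongr; linarith
    refine le_trans (le_of_eq ?_) (cell_energy w _ _ hj0 hlt)
    have : ((j+1:ℕ):ℝ)/N - (j:ℝ)/N = 1 / N := by push_cast; ring
    rw [this, div_div_eq_mul_div, div_one, mul_comm]
  -- mass
  have vd_cont : ContinuousOn (fun x => v x ^ 2 / x ^ 2) (Set.Ioi 0) :=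
    (vcont.pow 2).continuousOn.div (by fun_prop) (fun x hx => pow_ne_zero 2 (ne_of_gt hx))
  have vd_int : IntervalIntegrable (fun x => v x ^ 2 / x ^ 2) volume d 1 :=
    (vd_cont.mono (fun x hx => uIcc_pos hd hd1 hx)).intervalIntegrable
  have zeq : Set.EqOn (fun x => v x ^ 2 / x ^ 2) (fun _ => (0:ℝ)) (Set.Ioo 0 d) := by
    intro x hx
    simp [vzero x hx.1.le hx.2]
  have v0_int : IntervalIntegrable (fun x => v x ^ 2 / x ^ 2) volume 0 d := by
    have : IntervalIntegrable (fun _ : ℝ => (0:ℝ)) volume 0 d := by simp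
    refine this.congr_uIoo ?_
    rw [uIoo_of_le hd.le]; exact zeq.symm
  have mass : L / 2 - 8 / k ≤ ∫ x in (0:ℝ)..1, (v x) ^ 2 / x ^ 2 := by
    rw [← intervalIntegral.integral_add_adjacent_intervals v0_int vd_int,
      intervalIntegral.integral_congr_Ioo_of_le hd.le zeq]
    simp only [intervalIntegral.integral_zero, zero_add]
    have i1 : IntervalIntegrable (fun x => tu w x ^ 2 / x ^ 2) volume d 1 :=
      ((sq_cont w).mono (fun x hx => uIcc_pos hd hd1 hx)).intervalIntegrable
    have i2 : IntervalIntegrable (fun x : ℝ => √x / x ^ 2) volume d 1 :=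
      (err_cont.mono (fun x hx => uIcc_pos hd hd1 hx)).intervalIntegrable
    have hs := sqrt_pos.2 hd
    set M := 2 / √d / N with hM
    have hM0 : 0 < M := by positivity
    have hle : ∫ x in d..1, (tu w x ^ 2 / x ^ 2 - 2 * M * (√x / x ^ 2)) ≤
        ∫ x in d..1, v x ^ 2 / x ^ 2 := by
      refine intervalIntegral.integral_mono_on_of_le_Ioo hd1 (i1.sub (i2.const_mul _)) vd_int ?_
      intro x hx
      have hx0 : 0 < x := hd.trans hx.1
      have e1 := vclose x hx.1.le hx.2
      have e2 := tu_abs w x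
      have e3 : |tu w x * (tu w x - v x)| ≤ √x * M := by
        rw [abs_mul]; exact mul_le_mul e2 e1 (abs_nonneg _) (sqrt_nonneg _)
      have e4 := (abs_le.1 e3).2
      have : tu w x ^ 2 / x ^ 2 - 2 * M * (√x / x ^ 2) = (tu w x ^ 2 - 2 * M * √x) / x ^ 2 := by
        ring
      rw [this]
      refine div_le_div_of_nonneg_right ?_ (by positivity)
      nlinarith [sq_nonneg (tu w x - v x)]
    rw [intervalIntegral.integral_sub i1 (i2.const_mul _), intervalIntegral.integral_const_mul,
      tot_mass L d hL0 hd hd1 hL] at hle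
    have he := err_int d hd hd1
    have : 2 * M * (∫ x in d..1, √x / x ^ 2) ≤ 8 / k := by
      refine (mul_le_mul_of_nonneg_left he (by positivity)).trans (le_of_eq ?_)
      rw [hM, show 2 * (2 / √d / N) * (2 / √d) = 8 / (√d * √d) / N by field_simp; norm_num,
        mul_self_sqrt hd.le, hd_def]
      field_simp
    linarith
  have hmp : 0 < L / 2 - 8 / (k:ℝ) := by linarith
  have hbdd : BddBelow { s : ℝ | ∃ v : ℝ → ℝ, MemVh N v ∧ v 0 = 0 ∧
      (∃ x ∈ Set.Icc (0:ℝ) 1, v x ≠ 0) ∧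
      s = (∫ x in (0:ℝ)..1, (deriv v x) ^ 2) / (∫ x in (0:ℝ)..1, (v x) ^ 2 / x ^ 2) } := by
    refine ⟨0, ?_⟩
    rintro s ⟨v, -, -, -, rfl⟩
    exact div_nonneg (intervalIntegral.integral_nonneg zero_le_one (fun x _ => by positivity))
      (intervalIntegral.integral_nonneg zero_le_one (fun x _ => by positivity))
  have hmem : Sdisc N ≤ (∫ x in (0:ℝ)..1, (deriv v x) ^ 2) /
      (∫ x in (0:ℝ)..1, (v x) ^ 2 / x ^ 2) := by
    refine csInf_le hbdd ⟨v, ⟨vcont.continuousOn, ?_⟩, vzero 0 le_rfl hd, ?_, rfl⟩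
    · intro j hj
      refine ⟨(f (j+1) - f j) * N, f j - (f (j+1) - f j) * j, fun x hx => ?_⟩
      rw [hv, vcell j hj x hx]; ring
    · by_contra hcon
      push Not at hcon
      have : ∫ x in (0:ℝ)..1, (v x) ^ 2 / x ^ 2 = ∫ x in (0:ℝ)..1, (0:ℝ) := by
        refine intervalIntegral.integral_congr_Ioo_of_le zero_le_one fun x hx => ?_
        simp [hcon x (Ioo_subset_Icc_self hx)]
      rw [intervalIntegral.integral_zero] at this
      linarith
  refine hmem.trans (div_le_div₀ ?_ energy hmp mass)
  positivity

lemma asym (η : ℝ) (hη : 0 < η) : ∃ N₀ : ℕ, ∀ N : ℕ, N₀ ≤ N →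
    Sdisc N ≤ 1/4 + (π ^ 2 + η) / (log N) ^ 2 := by
  have hl : Tendsto (fun N : ℕ => log (N:ℝ)) atTop atTop :=
    tendsto_log_atTop.comp tendsto_natCast_atTop_atTop
  have hll : Tendsto (fun l : ℝ => log l / l) atTop (nhds 0) :=
    isLittleO_log_id_atTop.tendsto_div_nhds_zero
  have hinv : Tendsto (fun l : ℝ => l⁻¹) atTop (nhds 0) := tendsto_inv_atTop_zero
  set A := π ^ 2 + η with hA
  -- r l : lower bound for L / l
  set r : ℝ → ℝ := fun l => 1 - 2 * (log l / l) - l⁻¹ with hr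
  have hrt : Tendsto r atTop (nhds 1) := by
    have := ((hll.const_mul 2).const_sub 1).sub hinv
    simpa using this
  have h1 : Tendsto (fun l => A * r l - 2 * (2 + 8 * A * (l⁻¹) ^ 2) * l⁻¹ - π ^ 2 * (r l)⁻¹)
      atTop (nhds (A * 1 - 2 * (2 + 8 * A * 0 ^ 2) * 0 - π ^ 2 * 1⁻¹)) :=
    ((hrt.const_mul A).sub (((((hinv.pow 2).const_mul (8 * A)).const_add 2).const_mul 2).mul
      hinv)).sub ((hrt.inv₀ one_ne_zero).const_mul _)
  have h2 : ∀ᶠ l : ℝ in atTop,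
      0 < A * r l - 2 * (2 + 8 * A * (l⁻¹) ^ 2) * l⁻¹ - π ^ 2 * (r l)⁻¹ :=
    h1.eventually_const_lt (by rw [hA]; simp; linarith)
  have h3 : ∀ᶠ l : ℝ in atTop, 1 / 2 < r l := hrt.eventually_const_lt (by norm_num)
  have h4 := hl.eventually (h2.and (h3.and (eventually_ge_atTop 100)))
  obtain ⟨N₀, hN₀⟩ := eventually_atTop.1 h4
  refine ⟨max N₀ 1, fun N hN => ?_⟩
  obtain ⟨g1, g2, g3⟩ := hN₀ N ((le_max_left _ _).trans hN)
  have hN1 : 1 ≤ N := (le_max_right _ _).trans hN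
  have hN' : (0:ℝ) < N := by exact_mod_cast hN1
  set l := log (N:ℝ) with hl_def
  have hl0 : 0 < l := by linarith
  set k := ⌈l ^ 2⌉₊ with hk
  have hk1 : l ^ 2 ≤ k := Nat.le_ceil _
  have hk2 : (k:ℝ) < l ^ 2 + 1 := Nat.ceil_lt_add_one (by positivity)
  have hk0 : (0:ℝ) < k := by nlinarith
  set L := l - log k with hL_def
  have hlogk : log k ≤ 2 * log l + 1 := by
    have : log k ≤ log (l ^ 2 * exp 1) := by
      apply log_le_log hk0
      have := add_one_le_exp (1:ℝ)
      nlinarith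
    rw [log_mul (by positivity) (by positivity), log_exp, log_pow] at this
    simpa using this
  have hrL : r l * l ≤ L := by
    have : r l * l = l - 2 * log l - 1 := by
      simp only [hr]; field_simp
    rw [this]; linarith
  have hL50 : 50 ≤ L := by nlinarith
  have hL0 : 0 < L := by linarith
  have hlog : log ((k:ℝ) / N) = -L := by
    rw [log_div hk0.ne' hN'.ne']; ring
  have hkN : k < N := by
    have : log (k:ℝ) < log N := by linarith
    have := (log_lt_log_iff hk0 hN').1 this
    exact_mod_cast this
  have hkl : 8 / (k:ℝ) ≤ 8 / l ^ 2 := by gcongr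
  have hkk : 8 / (k:ℝ) < L / 2 := by
    have : 8 / l ^ 2 ≤ 8 := div_le_self (by norm_num) (by nlinarith)
    linarith
  have hA0 : 0 < A := by positivity
  refine (main_bound N k (by exact_mod_cast hk0) hkN L hlog (by linarith [pi_le_four]) hkk).trans ?_
  rw [div_le_iff₀ (by linarith)]
  have hrp : 0 < r l := by linarith
  have s1 : π ^ 2 / L ≤ π ^ 2 * (r l)⁻¹ * l⁻¹ := by
    rw [mul_assoc, ← mul_inv, ← div_eq_mul_inv]
    gcongr
  have s2 : A * r l * l⁻¹ ≤ A / l ^ 2 * L := by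
    have : A * r l * l⁻¹ = A / l ^ 2 * (r l * l) := by field_simp
    rw [this]; gcongr
  have s3 : (1/4 + A / l ^ 2) * (8 / k) ≤ (2 + 8 * A * (l⁻¹) ^ 2) * l⁻¹ * l⁻¹ := by
    have : (2 + 8 * A * (l⁻¹) ^ 2) * l⁻¹ * l⁻¹ = (1/4 + A / l ^ 2) * (8 / l ^ 2) := by
      field_simp; ring
    rw [this]; gcongr
  have s4 := mul_pos g1 (inv_pos.2 hl0)
  have s5 : π ^ 2 / (2 * L) = π ^ 2 / L / 2 := by field_simp
  rw [s5]
  nlinarith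

/-- Upper bound: `S_h ≤ 1/4 + π²/(|log h| − 3 log|log h|)² + η/(log h)²` for all
small enough `h = 1/N`. -/
theorem discrete_hardy_upper_bound :
    ∀ η : ℝ, 0 < η → ∃ N₀ : ℕ, ∀ N : ℕ, N₀ ≤ N →
      Sdisc N ≤ 1/4
        + π ^ 2 / (|Real.log (1 / (N : ℝ))| - 3 * Real.log |Real.log (1 / (N : ℝ))|) ^ 2
        + η / (Real.log (1 / (N : ℝ))) ^ 2 := by
  intro η hη
  obtain ⟨N₁, h1⟩ := asym η hη
  have hl : Tendsto (fun N : ℕ => log (N:ℝ)) atTop atTop :=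
    tendsto_log_atTop.comp tendsto_natCast_atTop_atTop
  have hll : Tendsto (fun l : ℝ => log l / l) atTop (nhds 0) :=
    isLittleO_log_id_atTop.tendsto_div_nhds_zero
  have h2 := hl.eventually ((hll.eventually_lt_const (show (0:ℝ) < 1/6 by norm_num)).and
    (eventually_ge_atTop 1))
  obtain ⟨N₂, hN₂⟩ := eventually_atTop.1 h2
  refine ⟨max N₁ N₂, fun N hN => ?_⟩
  obtain ⟨g1, g2⟩ := hN₂ N ((le_max_right _ _).trans hN)
  have h := h1 N ((le_max_left _ _).trans hN)
  have e : log (1 / (N:ℝ)) = -log N := by rw [one_div, log_inv]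
  rw [e, abs_neg, neg_sq]
  set l := log (N:ℝ) with hl_def
  have hl0 : 0 < l := by linarith
  rw [abs_of_pos hl0]
  have hlog0 : 0 ≤ log l := log_nonneg g2
  rw [div_lt_iff₀ hl0] at g1
  have : π ^ 2 / l ^ 2 ≤ π ^ 2 / (l - 3 * log l) ^ 2 := by
    have : 0 < l - 3 * log l := by linarith
    gcongr
    linarith
  rw [add_div] at h
  linarith
end
end

section
/- Fix an integer n ≥ 3 and for a positive integer N set h = 1/N. Then liminf_{N→∞} (S^n_h − S^n)·(log h)² ≥ π² and limsup_{N→∞} (S^n_h − S^n)·(log h)² ≤ (n+1)²·π²/4; that is, S^n + π²/|log h|² + o(1/|log h|²) ≤ S^n_h ≤ S^n + (n+1)²π²/(4|log h|²) + o(1/|log h|²). -/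
open MeasureTheory Real Set Filter

noncomputable section

/-- The discrete Hardy constant `S^n_h` in dimension `n ≥ 3`, for `h = 1/N`. -/
def SdiscN (n N : ℕ) : ℝ :=
  sInf { s : ℝ | ∃ v : ℝ → ℝ, MemVh N v ∧ v 1 = 0 ∧ (∃ x ∈ Set.Icc (0:ℝ) 1, v x ≠ 0) ∧
    s = (∫ r in (0:ℝ)..1, r ^ (n - 1) * (deriv v r) ^ 2)
        / (∫ r in (0:ℝ)..1, r ^ (n - 3) * (v r) ^ 2) }

lemma memVh_cell {N : ℕ} {v : ℝ → ℝ} (hv : MemVh N v) {k : ℕ} (hk : k < N) :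
    ∃ a b : ℝ, (∀ x ∈ Set.Icc ((k : ℝ) / (N : ℝ)) (((k : ℝ) + 1) / (N : ℝ)), v x = a * x + b) ∧
      (∀ x ∈ Set.Ioo ((k : ℝ) / (N : ℝ)) (((k : ℝ) + 1) / (N : ℝ)), deriv v x = a) := by
  obtain ⟨a, b, hab⟩ := hv.2 k hk
  refine ⟨a, b, hab, fun x hx => ?_⟩
  have h1 : v =ᶠ[nhds x] fun y => a * y + b := by
    filter_upwards [Ioo_mem_nhds hx.1 hx.2] with y hy using hab y (Ioo_subset_Icc_self hy)
  rw [h1.deriv_eq]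
  simp

lemma cell_le {N : ℕ} (k : ℕ) : (k : ℝ) / (N : ℝ) ≤ ((k : ℝ) + 1) / (N : ℝ) := by
  gcongr; linarith

lemma intInt_deriv {N : ℕ} {v : ℝ → ℝ} (hv : MemVh N v) (q : ℕ) {i j : ℕ} (hij : i ≤ j)
    (hj : j ≤ N) :
    IntervalIntegrable (fun r => r ^ q * (deriv v r) ^ 2) volume ((i : ℝ) / N) ((j : ℝ) / N) := by
  induction j, hij using Nat.le_induction with
  | base => exact IntervalIntegrable.refl
  | succ j hij ih =>
    refine (ih (by omega)).trans ?_
    obtain ⟨a, b, -, h2⟩ := memVh_cell hv (k := j) (by omega)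
    push_cast
    have h : IntervalIntegrable (fun r : ℝ => r ^ q * a ^ 2) volume ((j : ℝ) / N) (((j : ℝ) + 1) / N) :=
      Continuous.intervalIntegrable (by fun_prop) _ _
    refine h.congr_uIoo ?_
    rw [uIoo_of_le (cell_le j)]
    intro x hx
    simp only [h2 x hx]

lemma node_mem {N i : ℕ} (hi : i ≤ N) : (i : ℝ) / N ∈ Set.Icc (0:ℝ) 1 := by
  refine ⟨by positivity, ?_⟩
  exact div_le_one_of_le₀ (by exact_mod_cast hi) (by positivity)

lemma intInt_val {N : ℕ} {v : ℝ → ℝ} (hv : MemVh N v) (q : ℕ) {i j : ℕ} (hi : i ≤ N)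
    (hj : j ≤ N) :
    IntervalIntegrable (fun r => r ^ q * (v r) ^ 2) volume ((i : ℝ) / N) ((j : ℝ) / N) := by
  apply ContinuousOn.intervalIntegrable
  have : Set.uIcc ((i : ℝ) / N) ((j : ℝ) / N) ⊆ Set.Icc 0 1 :=
    uIcc_subset_Icc (node_mem hi) (node_mem hj)
  exact (continuousOn_pow q).mul ((hv.1.mono this).pow 2)

def gfun (m k r : ℝ) : ℝ := -m - k * (Real.cos (k * (1 - Real.log r)) / Real.sin (k * (1 - Real.log r)))

lemma cell_ineq (p : ℕ) (m k a b α β : ℝ) (hm : 2 * m = p + 1) (ha : 0 < a) (hab : a ≤ b)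
    (hs : ∀ r ∈ Set.Icc a b, 0 < Real.sin (k * (1 - Real.log r))) :
    b ^ (p + 1) * gfun m k b * (α * b + β) ^ 2 - a ^ (p + 1) * gfun m k a * (α * a + β) ^ 2
      ≤ ∫ r in a..b, (r ^ (p + 2) * α ^ 2 - (m ^ 2 + k ^ 2) * (r ^ p * (α * r + β) ^ 2)) := by
  have hd : ∀ r ∈ Set.Icc a b, HasDerivAt
      (fun r => r ^ (p + 1) * gfun m k r * (α * r + β) ^ 2)
      ((((p : ℝ) + 1) * r ^ p * gfun m k r + r ^ (p + 1) * (-(k ^ 2 / r) / (Real.sin (k * (1 - Real.log r))) ^ 2)) * (α * r + β) ^ 2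
        + r ^ (p + 1) * gfun m k r * (2 * (α * r + β) * α)) r := by
    intro r hr
    have hr0 : 0 < r := lt_of_lt_of_le ha hr.1
    have h1 : HasDerivAt (fun r => k * (1 - Real.log r)) (k * (0 - r⁻¹)) r :=
      ((hasDerivAt_const r (1:ℝ)).sub (Real.hasDerivAt_log hr0.ne')).const_mul k
    have hsr := hs r hr
    have h2 := (hasDerivAt_const r (-m)).sub ((h1.cos.div h1.sin hsr.ne').const_mul k)
    have h3 : HasDerivAt (gfun m k) (-(k ^ 2 / r) / (Real.sin (k * (1 - Real.log r))) ^ 2) r := by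
      refine h2.congr_deriv ?_
      have := Real.sin_sq_add_cos_sq (k * (1 - Real.log r))
      field_simp
      linear_combination (-k^2) * this
    have h4 : HasDerivAt (fun r : ℝ => r ^ (p + 1)) (((p : ℝ) + 1) * r ^ p) r := by
      simpa using hasDerivAt_pow (p + 1) r
    have h5 : HasDerivAt (fun r : ℝ => (α * r + β) ^ 2) (2 * (α * r + β) * α) r := by
      have : HasDerivAt (fun r : ℝ => α * r + β) α r := by
        simpa using ((hasDerivAt_id r).const_mul α).add_const β
      have h6 := this.pow 2
      simp only [Nat.cast_ofNat, Nat.add_one_sub_one, pow_one] at h6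
      exact h6
    exact (h4.mul h3).mul h5
  refine intervalIntegral.sub_le_integral_of_hasDeriv_right_of_le hab
    (fun r hr => (hd r hr).continuousAt.continuousWithinAt)
    (fun r hr => (hd r (Ioo_subset_Icc_self hr)).hasDerivWithinAt)
    (Continuous.integrableOn_Icc (by fun_prop)) ?_
  intro r hr
  have hr0 : 0 < r := lt_of_lt_of_le ha hr.1.le
  have hsr := hs r (Ioo_subset_Icc_self hr)
  have hsc := Real.sin_sq_add_cos_sq (k * (1 - Real.log r))
  have hp : (p : ℝ) = 2 * m - 1 := by linarith
  have key : (r ^ (p + 2) * α ^ 2 - (m ^ 2 + k ^ 2) * (r ^ p * (α * r + β) ^ 2)) -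
      ((((p : ℝ) + 1) * r ^ p * gfun m k r + r ^ (p + 1) * (-(k ^ 2 / r) / (Real.sin (k * (1 - Real.log r))) ^ 2)) * (α * r + β) ^ 2
        + r ^ (p + 1) * gfun m k r * (2 * (α * r + β) * α)) =
      r ^ p * (r * α - gfun m k r * (α * r + β)) ^ 2 := by
    rw [hp]
    have e : k ^ 2 / (Real.sin (k * (1 - Real.log r))) ^ 2 = k ^ 2 + (gfun m k r + m) ^ 2 := by
      unfold gfun
      field_simp
      linear_combination (-k^2) * hsc
    have e2 : r ^ (p + 1) * (-(k ^ 2 / r) / (Real.sin (k * (1 - Real.log r))) ^ 2) =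
        - r ^ p * (k ^ 2 + (gfun m k r + m) ^ 2) := by
      rw [← e]; field_simp; ring
    rw [e2]
    ring
  have : 0 ≤ r ^ p * (r * α - gfun m k r * (α * r + β)) ^ 2 := by positivity
  linarith

lemma chain_ineq (p N : ℕ) (m k : ℝ) (hm : 2 * m = p + 1) (hN : 1 ≤ N) {v : ℝ → ℝ}
    (hv : MemVh N v) (hs : ∀ r ∈ Set.Icc (1 / (N : ℝ)) 1, 0 < Real.sin (k * (1 - Real.log r)))
    {j : ℕ} (h1j : 1 ≤ j) (hj : j ≤ N) :
    ((j : ℝ) / N) ^ (p + 1) * gfun m k ((j : ℝ) / N) * (v ((j : ℝ) / N)) ^ 2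
      - (((1 : ℕ) : ℝ) / N) ^ (p + 1) * gfun m k (((1 : ℕ) : ℝ) / N) * (v (((1 : ℕ) : ℝ) / N)) ^ 2
      ≤ ∫ r in (((1 : ℕ) : ℝ) / N)..((j : ℝ) / N),
        (r ^ (p + 2) * (deriv v r) ^ 2 - (m ^ 2 + k ^ 2) * (r ^ p * (v r) ^ 2)) := by
  have hint : ∀ {a b : ℕ}, a ≤ b → b ≤ N → IntervalIntegrable
      (fun r => r ^ (p + 2) * (deriv v r) ^ 2 - (m ^ 2 + k ^ 2) * (r ^ p * (v r) ^ 2)) volume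
      ((a : ℝ) / N) ((b : ℝ) / N) := fun hab hb =>
    (intInt_deriv hv (p + 2) hab hb).sub ((intInt_val hv p (hab.trans hb) hb).const_mul _)
  have hN0 : (0 : ℝ) < N := by exact_mod_cast hN
  induction j, h1j using Nat.le_induction with
  | base => simp
  | succ j hij ih =>
    rw [← intervalIntegral.integral_add_adjacent_intervals (hint hij (by omega))
      (hint (Nat.le_succ j) hj)]
    have ih := ih (by omega)
    obtain ⟨α, β, h1, h2⟩ := memVh_cell hv (k := j) (by omega)
    have hj0 : (1 : ℝ) ≤ j := by exact_mod_cast hij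
    have hjN : (j : ℝ) + 1 ≤ N := by exact_mod_cast hj
    have hc := cell_ineq p m k ((j : ℝ) / N) (((j : ℝ) + 1) / N) α β hm (by positivity) (cell_le j)
      (fun r hr => hs r ⟨le_trans (by gcongr) hr.1, hr.2.trans (div_le_one_of_le₀ hjN hN0.le)⟩)
    rw [← h1 _ (left_mem_Icc.2 (cell_le j)), ← h1 _ (right_mem_Icc.2 (cell_le j))] at hc
    rw [intervalIntegral.integral_congr_Ioo_of_le
      (g := fun r => r ^ (p + 2) * (deriv v r) ^ 2 - (m ^ 2 + k ^ 2) * (r ^ p * (v r) ^ 2))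
      (cell_le j) (fun r hr => by simp only [h2 r hr, h1 r (Ioo_subset_Icc_self hr)])] at hc
    push_cast at *
    linarith

lemma first_cell (p N : ℕ) (lam : ℝ) (hN : 1 ≤ N) {v : ℝ → ℝ} (hv : MemVh N v) :
    ∃ a B : ℝ, v (1 / (N : ℝ)) = a + B ∧
    ∫ r in (0:ℝ)..(1 / (N : ℝ)), (r ^ (p + 2) * (deriv v r) ^ 2 - lam * (r ^ p * (v r) ^ 2)) =
      (1 / (N : ℝ)) ^ (p + 1) * (B ^ 2 / (p + 3) - lam * (a ^ 2 / (p + 1) + 2 * a * B / (p + 2)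
        + B ^ 2 / (p + 3))) := by
  obtain ⟨α, β, h1, h2⟩ := memVh_cell hv (k := 0) (by omega)
  have hN0 : (0 : ℝ) < N := by exact_mod_cast hN
  simp only [Nat.cast_zero, zero_div, zero_add] at h1 h2
  have hh : (0:ℝ) ≤ 1 / (N : ℝ) := by positivity
  refine ⟨β, α * (1 / N), ?_, ?_⟩
  · rw [h1 _ (right_mem_Icc.2 hh)]; ring
  · rw [intervalIntegral.integral_congr_Ioo_of_le
      (g := fun r => (α ^ 2 - lam * α ^ 2) * r ^ (p + 2) - (2 * lam * α * β) * r ^ (p + 1)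
        - (lam * β ^ 2) * r ^ p) hh
      (fun r hr => by simp only [h2 r hr, h1 r (Ioo_subset_Icc_self hr)]; ring)]
    rw [intervalIntegral.integral_sub, intervalIntegral.integral_sub,
      intervalIntegral.integral_const_mul, intervalIntegral.integral_const_mul,
      intervalIntegral.integral_const_mul, integral_pow, integral_pow, integral_pow]
    · push_cast
      have e3 : (p : ℝ) + 2 + 1 = p + 3 := by ring
      have e2 : (p : ℝ) + 1 + 1 = p + 2 := by ring
      rw [e3, e2]
      generalize (1 / (N:ℝ)) = h
      simp only [ne_eq, Nat.add_eq_zero_iff, one_ne_zero, and_false, not_false_eq_true, zero_pow, OfNat.ofNat_ne_zero]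
      field_simp
      ring
    all_goals exact Continuous.intervalIntegrable (by fun_prop) _ _

lemma lower_main (p N : ℕ) (m k A : ℝ) (hm : 2 * m = p + 1) (hN : 1 ≤ N) (hA : 0 < A) (hk : 0 < k)
    (hkA : k * A ≤ 1) (hkL : k * (Real.log N + 1 + A) = π)
    (hQ : ∀ a B : ℝ, 0 ≤ B ^ 2 / (p + 3) - (m ^ 2 + k ^ 2) * (a ^ 2 / (p + 1) + 2 * a * B / (p + 2)
        + B ^ 2 / (p + 3)) + (m - 1 / A) * (a + B) ^ 2)
    {v : ℝ → ℝ} (hv : MemVh N v) (hv1 : v 1 = 0) :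
    (m ^ 2 + k ^ 2) * (∫ r in (0:ℝ)..1, r ^ p * (v r) ^ 2) ≤
      ∫ r in (0:ℝ)..1, r ^ (p + 2) * (deriv v r) ^ 2 := by
  have hN0 : (0 : ℝ) < N := by exact_mod_cast hN
  have hs : ∀ r ∈ Set.Icc (1 / (N : ℝ)) 1, 0 < Real.sin (k * (1 - Real.log r)) := by
    intro r hr
    have hr0 : 0 < r := lt_of_lt_of_le (by positivity) hr.1
    have h1 : Real.log r ≤ 0 := Real.log_nonpos hr0.le hr.2
    have h2 : -Real.log N ≤ Real.log r := by
      have := Real.log_le_log (by positivity) hr.1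
      simpa using this
    apply Real.sin_pos_of_pos_of_lt_pi
    · apply mul_pos hk; linarith
    · rw [← hkL]; apply mul_lt_mul_of_pos_left _ hk; linarith
  have hch := chain_ineq p N m k hm hN hv hs hN le_rfl
  obtain ⟨a, B, hB, hI⟩ := first_cell p N (m ^ 2 + k ^ 2) hN hv
  have hNN : (N : ℝ) / N = 1 := div_self hN0.ne'
  have i1 := intInt_deriv hv (p + 2) (Nat.zero_le 1) hN
  have i2 := intInt_deriv hv (p + 2) hN le_rfl
  have i3 := intInt_val hv p (Nat.zero_le N) hN
  have i4 := intInt_val hv p hN le_rfl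
  have j1 := i1.sub (i3.const_mul (m ^ 2 + k ^ 2))
  have j2 := i2.sub (i4.const_mul (m ^ 2 + k ^ 2))
  have hsum := intervalIntegral.integral_add_adjacent_intervals j1 j2
  have hsub := intervalIntegral.integral_sub (i1.trans i2) ((i3.trans i4).const_mul (m ^ 2 + k ^ 2))
  rw [intervalIntegral.integral_const_mul] at hsub
  simp only [hNN, Nat.cast_zero, zero_div, Nat.cast_one, hv1] at hch hsum hsub
  rw [hI] at hsum
  have hg : -gfun m k (1 / N) ≥ m - 1 / A := by
    unfold gfun
    have e : k * (1 - Real.log (1 / N)) = π - k * A := by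
      rw [← hkL]; simp; ring
    rw [e, Real.cos_pi_sub, Real.sin_pi_sub]
    have hkA0 : 0 < k * A := mul_pos hk hA
    have hpi : k * A < π / 2 := by linarith [Real.pi_gt_three]
    have hs := Real.sin_pos_of_pos_of_lt_pi hkA0 (by linarith)
    have hc := Real.cos_pos_of_mem_Ioo ⟨by linarith, hpi⟩
    have ht := Real.lt_tan hkA0 hpi
    rw [Real.tan_eq_sin_div_cos, lt_div_iff₀ hc] at ht
    have : k * (Real.cos (k * A) / Real.sin (k * A)) ≤ 1 / A := by
      rw [← mul_div_assoc, div_le_div_iff₀ hs hA]; linarith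
    rw [neg_div]
    linarith
  have hq := hQ a B
  rw [hB] at hch
  have h5 : (m - 1 / A) * (a + B) ^ 2 ≤ -gfun m k (1 / N) * (a + B) ^ 2 := by gcongr
  have h6 : 0 ≤ (1 / (N : ℝ)) ^ (p + 1) * ((B ^ 2 / (p + 3) - (m ^ 2 + k ^ 2) * (a ^ 2 / (p + 1) + 2 * a * B / (p + 2)
        + B ^ 2 / (p + 3))) + -gfun m k (1 / N) * (a + B) ^ 2) := by
    apply mul_nonneg (by positivity); linarith
  nlinarith [hsum, hsub, hch, h6]

lemma quad_pos (p : ℕ) (m δ ε : ℝ) (hm : 2 * m = p + 1) (hδ : 0 ≤ δ) (hε : 0 ≤ ε)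
    (h1 : 4 * (δ + ε) ≤ m / 2) (h2 : 18 * (δ + ε) ≤ (m + 1) / (2 * (2 * m + 1) ^ 2)) (a B : ℝ) :
    0 ≤ B ^ 2 / (p + 3) - (m ^ 2 + δ) * (a ^ 2 / (p + 1) + 2 * a * B / (p + 2)
        + B ^ 2 / (p + 3)) + (m - ε) * (a + B) ^ 2 := by
  have hp0 : (0 : ℝ) ≤ p := by positivity
  have hp : (p : ℝ) = 2 * m - 1 := by linarith
  have hm2 : 1 / 2 ≤ m := by linarith
  have q2 : a ^ 2 / ((p:ℝ) + 1) + 2 * a * B / (p + 2) + B ^ 2 / (p + 3) ≤ 2 * (a ^ 2 + B ^ 2) := by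
    have e1 : a ^ 2 / ((p:ℝ) + 1) ≤ a ^ 2 := div_le_self (by positivity) (by linarith)
    have e2 : B ^ 2 / ((p:ℝ) + 3) ≤ B ^ 2 := div_le_self (by positivity) (by linarith)
    have e3 : 2 * a * B / ((p:ℝ) + 2) ≤ a ^ 2 + B ^ 2 := by
      rw [div_le_iff₀ (by positivity)]
      nlinarith [sq_nonneg (a - B), sq_nonneg a, sq_nonneg B, mul_nonneg hp0 (add_nonneg (sq_nonneg a) (sq_nonneg B))]
    linarith
  have q3 : (a + B) ^ 2 ≤ 2 * (a ^ 2 + B ^ 2) := by nlinarith [sq_nonneg (a - B)]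
  set t := 2 * (m + 1) / (2 * m + 1) with ht
  have id1 : B ^ 2 / ((p:ℝ) + 3) - m ^ 2 * (a ^ 2 / (p + 1) + 2 * a * B / (p + 2)
        + B ^ 2 / (p + 3)) + m * (a + B) ^ 2 =
      m / 2 * (a + t * B) ^ 2 + (m + 1) / (2 * (2 * m + 1) ^ 2) * B ^ 2 := by
    rw [hp, ht]
    have : (2 * m - 1 + 1) = 2 * m := by ring
    rw [this]
    have : (2 * m - 1 + 2) = 2 * m + 1 := by ring
    rw [this]
    have : (2 * m - 1 + 3) = 2 * (m + 1) := by ring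
    rw [this]
    have : m ≠ 0 := by linarith
    have : m + 1 ≠ 0 := by linarith
    have : 2 * m + 1 ≠ 0 := by linarith
    field_simp
    ring
  have ht0 : 0 ≤ t := by positivity
  have ht2 : t ≤ 3 / 2 := by rw [ht, div_le_iff₀ (by linarith)]; linarith
  have q4 : a ^ 2 + B ^ 2 ≤ 2 * (a + t * B) ^ 2 + 9 * B ^ 2 := by
    have : t ^ 2 ≤ 9 / 4 := by nlinarith
    nlinarith [sq_nonneg (a + 2 * (t * B)), mul_nonneg (sub_nonneg.2 this) (sq_nonneg B)]
  have r1 := mul_le_mul_of_nonneg_left q2 hδ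
  have r2 := mul_le_mul_of_nonneg_left q3 hε
  have r3 := mul_le_mul_of_nonneg_left q4 (add_nonneg hδ hε)
  have r4 := mul_le_mul_of_nonneg_right h1 (sq_nonneg (a + t * B))
  have r5 := mul_le_mul_of_nonneg_right h2 (sq_nonneg B)
  nlinarith

def interpFn (N : ℕ) (c : ℕ → ℝ) (x : ℝ) : ℝ :=
  ∑ j ∈ Finset.range (N + 1), c j * max 0 (1 - |(N : ℝ) * x - j|)

lemma interpFn_cell {N : ℕ} (c : ℕ → ℝ) {k : ℕ} (hk : k < N) {x : ℝ}
    (hx : x ∈ Set.Icc ((k : ℝ) / (N : ℝ)) (((k : ℝ) + 1) / (N : ℝ))) :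
    interpFn N c x = c k * (1 - (N * x - k)) + c (k + 1) * (N * x - k) := by
  have hN0 : (0 : ℝ) < N := by exact_mod_cast (by omega : 0 < N)
  have h1 : (k : ℝ) ≤ N * x := by
    have := (div_le_iff₀ hN0).1 hx.1; linarith
  have h2 : N * x ≤ (k : ℝ) + 1 := by
    have := (le_div_iff₀ hN0).1 hx.2; linarith
  unfold interpFn
  rw [Finset.sum_eq_add (a := k) (b := k + 1) (by omega)]
  · have e1 : |(N : ℝ) * x - k| = N * x - k := abs_of_nonneg (by linarith)
    have e2 : |(N : ℝ) * x - (k + 1 : ℕ)| = k + 1 - N * x := by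
      push_cast; rw [abs_of_nonpos (by linarith)]; ring
    rw [e1, e2, max_eq_right (by linarith), max_eq_right (by linarith)]
    ring
  · intro j _ hj
    have : 1 - |(N : ℝ) * x - j| ≤ 0 := by
      rcases lt_or_gt_of_ne hj.1 with h | h
      · have : (j : ℝ) + 1 ≤ k := by exact_mod_cast h
        have := le_abs_self ((N : ℝ) * x - j)
        linarith
      · have : (k : ℝ) + 1 + 1 ≤ j := by
          have : k + 1 + 1 ≤ j := by have := hj.2; omega
          exact_mod_cast this
        have := neg_abs_le ((N : ℝ) * x - j)
        linarith
    rw [max_eq_left this, mul_zero]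
  · intro h; exact absurd (Finset.mem_range.2 (by omega)) h
  · intro h; exact absurd (Finset.mem_range.2 (by omega)) h

lemma interpFn_mem (N : ℕ) (c : ℕ → ℝ) : MemVh N (interpFn N c) := by
  refine ⟨Continuous.continuousOn (by unfold interpFn; fun_prop), fun k hk => ?_⟩
  refine ⟨N * (c (k + 1) - c k), c k - k * (c (k + 1) - c k), fun x hx => ?_⟩
  rw [interpFn_cell c hk hx]; ring

lemma interpFn_deriv {N : ℕ} (c : ℕ → ℝ) {k : ℕ} (hk : k < N) {x : ℝ}
    (hx : x ∈ Set.Ioo ((k : ℝ) / (N : ℝ)) (((k : ℝ) + 1) / (N : ℝ))) :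
    deriv (interpFn N c) x = N * (c (k + 1) - c k) := by
  have h1 : interpFn N c =ᶠ[nhds x] fun y => (N * (c (k + 1) - c k)) * y + (c k - k * (c (k + 1) - c k)) := by
    filter_upwards [Ioo_mem_nhds hx.1 hx.2] with y hy
    rw [interpFn_cell c hk (Ioo_subset_Icc_self hy)]; ring
  rw [h1.deriv_eq]
  simp

lemma mono_cells {N : ℕ} {φ ψ : ℝ → ℝ} {i j : ℕ} (hij : i ≤ j)
    (hφ : ∀ l, i ≤ l → l < j → IntervalIntegrable φ volume ((l : ℝ) / N) (((l + 1 : ℕ) : ℝ) / N))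
    (hψ : ∀ l, i ≤ l → l < j → IntervalIntegrable ψ volume ((l : ℝ) / N) (((l + 1 : ℕ) : ℝ) / N))
    (h : ∀ l, i ≤ l → l < j → ∀ r ∈ Set.Ioo ((l : ℝ) / (N : ℝ)) (((l : ℝ) + 1) / (N : ℝ)), φ r ≤ ψ r) :
    ∫ r in ((i : ℝ) / N)..((j : ℝ) / N), φ r ≤ ∫ r in ((i : ℝ) / N)..((j : ℝ) / N), ψ r := by
  rw [← intervalIntegral.sum_integral_adjacent_intervals_Ico (a := fun l : ℕ => (l : ℝ) / N) hij
      (fun l hl => hφ l hl.1 hl.2),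
    ← intervalIntegral.sum_integral_adjacent_intervals_Ico (a := fun l : ℕ => (l : ℝ) / N) hij
      (fun l hl => hψ l hl.1 hl.2)]
  apply Finset.sum_le_sum
  intro l hl
  rw [Finset.mem_Ico] at hl
  refine intervalIntegral.integral_mono_on_of_le_Ioo ?_ (hφ l hl.1 hl.2) (hψ l hl.1 hl.2) ?_
  · push_cast; exact cell_le l
  · intro r hr; push_cast at hr; exact h l hl.1 hl.2 r hr

def Ffun (q a b k r : ℝ) : ℝ := r ^ (-q) * (a * Real.cos (k * Real.log r) + b * Real.sin (k * Real.log r))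

lemma Ffun_deriv (q a b k r : ℝ) (hr : 0 < r) :
    HasDerivAt (Ffun q a b k) (Ffun (q + 1) (-q * a + k * b) (-q * b - k * a) k r) r := by
  have h1 : HasDerivAt (fun r => k * Real.log r) (k * r⁻¹) r := (Real.hasDerivAt_log hr.ne').const_mul k
  have h2 : HasDerivAt (fun r : ℝ => r ^ (-q)) (-q * r ^ (-q - 1)) r :=
    Real.hasDerivAt_rpow_const (Or.inl hr.ne')
  have h3 := h2.mul ((h1.cos.const_mul a).add (h1.sin.const_mul b))
  refine h3.congr_deriv ?_
  unfold Ffun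
  have e : r ^ (-q) = r ^ (-(q+1)) * r := by
    rw [← Real.rpow_add_one hr.ne']; congr 1; ring
  have e' : r ^ (-q - 1) = r ^ (-(q+1)) := by congr 1; ring
  simp only [Pi.add_apply]
  rw [e, e']
  field_simp
  ring

lemma Ffun_bound (q a b k r x : ℝ) (hx : 0 < x) (hr : x ≤ r) (hq : 0 ≤ q) :
    |Ffun q a b k r| ≤ x ^ (-q) * (|a| + |b|) := by
  unfold Ffun
  have hr0 : 0 < r := hx.trans_le hr
  rw [abs_mul, abs_of_pos (Real.rpow_pos_of_pos hr0 _)]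
  have h1 : r ^ (-q) ≤ x ^ (-q) := Real.rpow_le_rpow_of_nonpos hx hr (by linarith)
  have h2 : |a * Real.cos (k * Real.log r) + b * Real.sin (k * Real.log r)| ≤ |a| + |b| := by
    refine (abs_add_le _ _).trans ?_
    rw [abs_mul, abs_mul]
    have := mul_le_mul_of_nonneg_left (Real.abs_cos_le_one (k * Real.log r)) (abs_nonneg a)
    have := mul_le_mul_of_nonneg_left (Real.abs_sin_le_one (k * Real.log r)) (abs_nonneg b)
    linarith
  gcongr

lemma Ffun_cont (q a b k : ℝ) : ContinuousOn (Ffun q a b k) (Set.Ioi 0) :=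
  fun r hr => (Ffun_deriv q a b k r hr).continuousAt.continuousWithinAt

/-- the two pointwise interpolation error bounds on a cell -/
lemma cell_interp (p : ℕ) (m k x h : ℝ) (hm : 2 * m = p + 1) (hk0 : 0 < k) (hk1 : k ≤ 1)
    (hh : 0 < h) (hhx : h ≤ x) (σ : ℝ)
    (hσ : σ = (Ffun m 0 1 k (x + h) - Ffun m 0 1 k x) / h) (r : ℝ) (hr : r ∈ Set.Ioo x (x + h)) :
    r ^ (p + 2) * σ ^ 2 ≤ r ^ (p + 2) * (Ffun (m + 1) k (-m) k r) ^ 2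
        + 2 ^ (p + 5) * ((m + 2) ^ 2) ^ 2 * h / r ^ 2 ∧
    r ^ p * (Ffun m 0 1 k r) ^ 2 ≤ r ^ p * (Ffun m 0 1 k x + σ * (r - x)) ^ 2
        + 2 ^ (p + 5) * ((m + 2) ^ 2) ^ 2 * h / r ^ 2 := by
  have hx : 0 < x := hh.trans_le hhx
  have hp0 : (0 : ℝ) ≤ p := by positivity
  have hm0 : 0 < m := by linarith
  set K := (m + 2) ^ 2 with hK
  have hK1 : 1 ≤ K := by nlinarith
  set X := x ^ (-m) with hX
  have hX0 : 0 < X := Real.rpow_pos_of_pos hx _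
  have hX1 : x ^ (-(m + 1)) = X / x := by
    rw [hX, ← Real.rpow_sub_one hx.ne']; congr 1; ring
  have hX2 : x ^ (-(m + 1 + 1)) = X / x ^ 2 := by
    rw [show -(m + 1 + 1) = -(m+1) - 1 by ring, Real.rpow_sub_one hx.ne', hX1]; field_simp
  have hXX : X ^ 2 * x ^ (p + 1) = 1 := by
    rw [hX, ← Real.rpow_natCast, ← Real.rpow_mul hx.le, ← Real.rpow_natCast x, ← Real.rpow_add hx]
    have : -m * ((2:ℕ):ℝ) + ((p + 1 : ℕ) : ℝ) = 0 := by push_cast; linarith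
    rw [this, Real.rpow_zero]
  have hf' : ∀ y, x ≤ y → HasDerivAt (Ffun m 0 1 k) (Ffun (m + 1) k (-m) k y) y := by
    intro y hy
    have := Ffun_deriv m 0 1 k y (hx.trans_le hy)
    simpa using this
  have b0 : ∀ y, x ≤ y → |Ffun m 0 1 k y| ≤ K * X := by
    intro y hy
    refine (Ffun_bound m 0 1 k y x hx hy hm0.le).trans ?_
    rw [← hX]; simp; nlinarith
  have b1 : ∀ y, x ≤ y → |Ffun (m + 1) k (-m) k y| ≤ K * (X / x) := by
    intro y hy
    refine (Ffun_bound (m + 1) k (-m) k y x hx hy (by linarith)).trans ?_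
    rw [hX1, mul_comm, abs_of_pos hk0, abs_neg, abs_of_pos hm0]
    gcongr
    nlinarith
  have b2 : ∀ y, x ≤ y → |Ffun (m + 1 + 1) (-(m+1) * k + k * (-m)) (-(m+1) * (-m) - k * k) k y| ≤ K * (X / x ^ 2) := by
    intro y hy
    refine (Ffun_bound _ _ _ k y x hx hy (by linarith)).trans ?_
    rw [hX2, mul_comm]
    gcongr
    have c1 : |(-(m+1) * k + k * (-m))| ≤ 2 * m + 1 := by
      rw [abs_le]; constructor <;> nlinarith
    have c2 : |(-(m+1) * (-m) - k * k)| ≤ m * (m + 1) + 1 := by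
      rw [abs_le]; constructor <;> nlinarith
    nlinarith
  -- Lipschitz bounds
  have l0 : ∀ y z, x ≤ y → x ≤ z → |Ffun m 0 1 k z - Ffun m 0 1 k y| ≤ K * (X / x) * |z - y| := by
    intro y z hy hz
    exact Convex.norm_image_sub_le_of_norm_hasDerivWithin_le (s := Set.Ici x)
      (fun w hw => (hf' w hw).hasDerivWithinAt) (fun w hw => b1 w hw) (convex_Ici x) hy hz
  have l1 : ∀ y z, x ≤ y → x ≤ z → |Ffun (m + 1) k (-m) k z - Ffun (m + 1) k (-m) k y| ≤ K * (X / x ^ 2) * |z - y| := by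
    intro y z hy hz
    exact Convex.norm_image_sub_le_of_norm_hasDerivWithin_le (s := Set.Ici x)
      (fun w hw => (Ffun_deriv (m + 1) k (-m) k w (hx.trans_le hw)).hasDerivWithinAt)
      (fun w hw => b2 w hw) (convex_Ici x) hy hz
  obtain ⟨ξ, hξ, hξe⟩ := exists_hasDerivAt_eq_slope (Ffun m 0 1 k) (Ffun (m + 1) k (-m) k)
    (by linarith : x < x + h) (fun y hy => (hf' y hy.1).continuousAt.continuousWithinAt)
    (fun y hy => hf' y hy.1.le)
  rw [add_sub_cancel_left, ← hσ] at hξe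
  have hr0 : 0 < r := hx.trans hr.1
  have hr2 : r ≤ 2 * x := by linarith [hr.2]
  have hσb : |σ| ≤ K * (X / x) := hξe ▸ b1 ξ hξ.1.le
  have habs : |r - x| ≤ h := by rw [abs_le]; constructor <;> linarith [hr.1, hr.2]
  have hinv : h / x ^ 2 ≤ 4 * (h / r ^ 2) := by
    rw [← mul_div_assoc, div_le_div_iff₀ (by positivity) (by positivity)]
    have : r ^ 2 ≤ 4 * x ^ 2 := by nlinarith
    nlinarith
  constructor
  · have d1 : |σ - Ffun (m + 1) k (-m) k r| ≤ K * (X / x ^ 2) * h := by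
      rw [← hξe]
      refine (l1 r ξ hr.1.le hξ.1.le).trans ?_
      gcongr
      rw [abs_le]; constructor <;> linarith [hr.1, hr.2, hξ.1, hξ.2]
    have d2 : |σ + Ffun (m + 1) k (-m) k r| ≤ 2 * (K * (X / x)) := by
      refine (abs_add_le _ _).trans ?_
      linarith [b1 r hr.1.le]
    have d3 : σ ^ 2 - (Ffun (m + 1) k (-m) k r) ^ 2 ≤ (K * (X / x ^ 2) * h) * (2 * (K * (X / x))) := by
      calc σ ^ 2 - (Ffun (m + 1) k (-m) k r) ^ 2 = (σ - Ffun (m + 1) k (-m) k r) * (σ + Ffun (m + 1) k (-m) k r) := by ring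
        _ ≤ |(σ - Ffun (m + 1) k (-m) k r) * (σ + Ffun (m + 1) k (-m) k r)| := le_abs_self _
        _ = |σ - Ffun (m + 1) k (-m) k r| * |σ + Ffun (m + 1) k (-m) k r| := abs_mul _ _
        _ ≤ _ := by gcongr
    have d4 : r ^ (p + 2) * ((K * (X / x ^ 2) * h) * (2 * (K * (X / x)))) ≤ 2 ^ (p + 5) * K ^ 2 * h / r ^ 2 := by
      calc r ^ (p + 2) * ((K * (X / x ^ 2) * h) * (2 * (K * (X / x))))
          ≤ (2 * x) ^ (p + 2) * ((K * (X / x ^ 2) * h) * (2 * (K * (X / x)))) := by gcongr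
        _ = 2 ^ (p + 3) * K ^ 2 * (h / x ^ 2) * (X ^ 2 * x ^ (p + 1)) := by
            rw [mul_pow]; field_simp; ring
        _ = 2 ^ (p + 3) * K ^ 2 * (h / x ^ 2) := by rw [hXX, mul_one]
        _ ≤ 2 ^ (p + 3) * K ^ 2 * (4 * (h / r ^ 2)) := by gcongr
        _ = _ := by ring
    have d5 := mul_le_mul_of_nonneg_left d3 (pow_nonneg hr0.le (p + 2))
    linarith
  · set e := Ffun m 0 1 k x + σ * (r - x) with he
    have d1 : |Ffun m 0 1 k r - e| ≤ 2 * (K * (X / x) * h) := by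
      have : Ffun m 0 1 k r - e = (Ffun m 0 1 k r - Ffun m 0 1 k x) - σ * (r - x) := by rw [he]; ring
      rw [this]
      refine (abs_sub _ _).trans ?_
      rw [abs_mul]
      have a1 := l0 x r le_rfl hr.1.le
      have a2 : K * (X / x) * |r - x| ≤ K * (X / x) * h := by gcongr
      have a3 : |σ| * |r - x| ≤ K * (X / x) * h := by gcongr
      linarith
    have d1' : 2 * (K * (X / x) * h) ≤ 2 * (K * X) := by
      have : X / x * h ≤ X := by
        rw [div_mul_eq_mul_div, div_le_iff₀ hx]; gcongr
      have := mul_le_mul_of_nonneg_left this (by positivity : 0 ≤ K)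
      linarith
    have d2 : |Ffun m 0 1 k r + e| ≤ 4 * (K * X) := by
      have : Ffun m 0 1 k r + e = 2 * Ffun m 0 1 k r - (Ffun m 0 1 k r - e) := by ring
      rw [this]
      refine (abs_sub _ _).trans ?_
      rw [abs_mul, abs_two]
      linarith [b0 r hr.1.le]
    have d3 : (Ffun m 0 1 k r) ^ 2 - e ^ 2 ≤ (2 * (K * (X / x) * h)) * (4 * (K * X)) := by
      calc (Ffun m 0 1 k r) ^ 2 - e ^ 2 = (Ffun m 0 1 k r - e) * (Ffun m 0 1 k r + e) := by ring
        _ ≤ |(Ffun m 0 1 k r - e) * (Ffun m 0 1 k r + e)| := le_abs_self _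
        _ = |Ffun m 0 1 k r - e| * |Ffun m 0 1 k r + e| := abs_mul _ _
        _ ≤ _ := by gcongr
    have d4 : r ^ p * ((2 * (K * (X / x) * h)) * (4 * (K * X))) ≤ 2 ^ (p + 5) * K ^ 2 * h / r ^ 2 := by
      calc r ^ p * ((2 * (K * (X / x) * h)) * (4 * (K * X)))
          ≤ (2 * x) ^ p * ((2 * (K * (X / x) * h)) * (4 * (K * X))) := by gcongr
        _ = 2 ^ (p + 3) * K ^ 2 * (h / x ^ 2) * (X ^ 2 * x ^ (p + 1)) := by
            rw [mul_pow]; field_simp; ring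
        _ = 2 ^ (p + 3) * K ^ 2 * (h / x ^ 2) := by rw [hXX, mul_one]
        _ ≤ 2 ^ (p + 3) * K ^ 2 * (4 * (h / r ^ 2)) := by gcongr
        _ = _ := by ring
    have d5 := mul_le_mul_of_nonneg_left d3 (pow_nonneg hr0.le p)
    linarith

lemma exact_den (p : ℕ) (m k r0 : ℝ) (hm : 2 * m = p + 1) (hk0 : 0 < k) (hr0 : 0 < r0) (hr1 : r0 ≤ 1)
    (hk : k * Real.log r0 = -π) :
    ∫ r in r0..1, r ^ p * (Ffun m 0 1 k r) ^ 2 = -Real.log r0 / 2 := by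
  have hpos : ∀ r ∈ Set.uIcc r0 1, 0 < r := fun r hr => by
    rw [uIcc_of_le hr1] at hr; exact hr0.trans_le hr.1
  rw [intervalIntegral.integral_eq_sub_of_hasDerivAt
    (f := fun r => Real.log r / 2 - Real.sin (2 * (k * Real.log r)) / (4 * k))]
  · have : 2 * (k * Real.log r0) = -(2 * π) := by rw [hk]; ring
    simp only [this]
    simp
    ring
  · intro r hr
    have hr := hpos r hr
    have h1 : HasDerivAt (fun r => 2 * (k * Real.log r)) (2 * (k * r⁻¹)) r :=
      ((Real.hasDerivAt_log hr.ne').const_mul k).const_mul 2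
    have h2 := ((Real.hasDerivAt_log hr.ne').div_const 2).sub (h1.sin.div_const (4 * k))
    refine h2.congr_deriv ?_
    unfold Ffun
    have e : (r ^ (-m)) ^ 2 * r ^ (p + 1) = 1 := by
      rw [← Real.rpow_natCast, ← Real.rpow_mul hr.le, ← Real.rpow_natCast r, ← Real.rpow_add hr]
      have : -m * ((2:ℕ):ℝ) + ((p + 1 : ℕ) : ℝ) = 0 := by push_cast; linarith
      rw [this, Real.rpow_zero]
    have e2 : r ^ p * (r ^ (-m)) ^ 2 = r⁻¹ := by
      field_simp; rw [← e]; ring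
    have e3 : r ^ p * (r ^ (-m) * (0 * Real.cos (k * Real.log r) + 1 * Real.sin (k * Real.log r))) ^ 2
        = r⁻¹ * Real.sin (k * Real.log r) ^ 2 := by rw [← e2]; ring
    rw [e3, Real.cos_two_mul]
    have := Real.sin_sq_add_cos_sq (k * Real.log r)
    field_simp
    linear_combination (-8) * this
  · apply ContinuousOn.intervalIntegrable
    exact (continuousOn_pow p).mul (((Ffun_cont m 0 1 k).mono hpos).pow 2)

lemma exact_num (p : ℕ) (m k r0 : ℝ) (hm : 2 * m = p + 1) (hr0 : 0 < r0) (hr1 : r0 ≤ 1)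
    (hk : k * Real.log r0 = -π) :
    ∫ r in r0..1, r ^ (p + 2) * (Ffun (m + 1) k (-m) k r) ^ 2 =
      (m ^ 2 + k ^ 2) * ∫ r in r0..1, r ^ p * (Ffun m 0 1 k r) ^ 2 := by
  have hpos : ∀ r ∈ Set.uIcc r0 1, 0 < r := fun r hr => by
    rw [uIcc_of_le hr1] at hr; exact hr0.trans_le hr.1
  have i1 : IntervalIntegrable (fun r => r ^ p * (Ffun m 0 1 k r) ^ 2) volume r0 1 := by
    apply ContinuousOn.intervalIntegrable
    exact (continuousOn_pow p).mul (((Ffun_cont m 0 1 k).mono hpos).pow 2)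
  have i2 : IntervalIntegrable (fun r => r ^ (p + 2) * (Ffun (m + 1) k (-m) k r) ^ 2) volume r0 1 := by
    apply ContinuousOn.intervalIntegrable
    exact (continuousOn_pow _).mul (((Ffun_cont _ _ _ k).mono hpos).pow 2)
  have h := intervalIntegral.integral_eq_sub_of_hasDerivAt
    (f := fun r => r ^ (p + 2) * (Ffun m 0 1 k r * Ffun (m + 1) k (-m) k r))
    (f' := fun r => r ^ (p + 2) * (Ffun (m + 1) k (-m) k r) ^ 2 - (m ^ 2 + k ^ 2) * (r ^ p * (Ffun m 0 1 k r) ^ 2))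
    (a := r0) (b := 1) ?_ (i2.sub (i1.const_mul _))
  · rw [intervalIntegral.integral_sub i2 (i1.const_mul _), intervalIntegral.integral_const_mul] at h
    have z1 : Ffun m 0 1 k 1 = 0 := by simp [Ffun]
    have z2 : Ffun m 0 1 k r0 = 0 := by simp [Ffun, hk]
    rw [z1, z2] at h
    simp only [zero_mul, mul_zero, sub_zero] at h
    linarith
  · intro r hr
    have hr := hpos r hr
    have h1 : HasDerivAt (fun r : ℝ => r ^ (p + 2)) (((p : ℝ) + 2) * r ^ (p + 1)) r := by
      simpa using hasDerivAt_pow (p + 2) r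
    have h2 := h1.mul ((Ffun_deriv m 0 1 k r hr).mul (Ffun_deriv (m + 1) k (-m) k r hr))
    refine h2.congr_deriv ?_
    have e1 : r ^ (-m) = r ^ (-(m + 1 + 1)) * r ^ 2 := by
      rw [← Real.rpow_natCast, ← Real.rpow_add hr]; congr 1; push_cast; ring
    have e2 : r ^ (-(m + 1)) = r ^ (-(m + 1 + 1)) * r := by
      rw [← Real.rpow_add_one hr.ne']; congr 1; ring
    have hp : (p : ℝ) = 2 * m - 1 := by linarith
    simp only [Ffun, Pi.mul_apply, e1, e2, hp]
    ring

lemma upper_main (p N M : ℕ) (m k : ℝ) (hm : 2 * m = p + 1) (hM : 1 ≤ M) (hMN : M < N)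
    (hk0 : 0 < k) (hk1 : k ≤ 1) (hk : k * Real.log ((M : ℝ) / N) = -π) :
    ∃ v : ℝ → ℝ, MemVh N v ∧ v 1 = 0 ∧
      (∫ r in (0:ℝ)..1, r ^ (p + 2) * (deriv v r) ^ 2) ≤
        (m ^ 2 + k ^ 2) * (-Real.log ((M : ℝ) / N) / 2) + 2 ^ (p + 5) * ((m + 2) ^ 2) ^ 2 / M ∧
      -Real.log ((M : ℝ) / N) / 2 - 2 ^ (p + 5) * ((m + 2) ^ 2) ^ 2 / M ≤
        ∫ r in (0:ℝ)..1, r ^ p * (v r) ^ 2 := by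
  have hN0 : (0 : ℝ) < N := by exact_mod_cast (by omega : 0 < N)
  have hM0 : (0 : ℝ) < M := by exact_mod_cast hM
  set C : ℝ := 2 ^ (p + 5) * ((m + 2) ^ 2) ^ 2 with hC
  have hC0 : 0 ≤ C := by positivity
  set r0 : ℝ := (M : ℝ) / N with hr0d
  have hr0 : 0 < r0 := by positivity
  have hr1 : r0 ≤ 1 := (node_mem hMN.le).2
  set f := Ffun m 0 1 k with hf
  have z1 : f 1 = 0 := by simp [hf, Ffun]
  have z2 : f r0 = 0 := by simp [hf, Ffun, hk]
  set c : ℕ → ℝ := fun j => if j < M then 0 else f ((j : ℝ) / N) with hc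
  have hcM : ∀ j, j ≤ M → c j = 0 := by
    intro j hj
    rcases hj.lt_or_eq with h | h
    · simp [hc, h]
    · subst h; simp only [hc, lt_irrefl, if_false]; exact z2
  have hcf : ∀ j, M ≤ j → c j = f ((j : ℝ) / N) := by
    intro j hj
    simp [hc, not_lt.2 hj]
  set v := interpFn N c with hvd
  have hv : MemVh N v := interpFn_mem N c
  have hNN : (N : ℝ) / N = 1 := div_self hN0.ne'
  have hpos : ∀ r ∈ Set.uIcc r0 1, 0 < r := fun r hr => by
    rw [uIcc_of_le hr1] at hr; exact hr0.trans_le hr.1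
  have hE : ∀ l, M ≤ l → l < N → ∀ r ∈ Set.Ioo ((l : ℝ) / (N : ℝ)) (((l : ℝ) + 1) / (N : ℝ)),
      r ^ (p + 2) * (deriv v r) ^ 2 ≤ r ^ (p + 2) * (Ffun (m + 1) k (-m) k r) ^ 2 + C * (1 / N) / r ^ 2 ∧
      r ^ p * (f r) ^ 2 ≤ r ^ p * (v r) ^ 2 + C * (1 / N) / r ^ 2 := by
    intro l hl hlN r hr
    have e : ((l : ℝ) + 1) / (N : ℝ) = (l : ℝ) / N + 1 / N := by ring
    have h1l : (1 : ℝ) ≤ l := by exact_mod_cast hM.trans hl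
    have hcell := cell_interp p m k ((l : ℝ) / N) (1 / N) hm hk0 hk1 (by positivity)
      (by gcongr) (deriv v r) (by
        rw [hvd, interpFn_deriv c hlN hr, hcf l hl, hcf (l + 1) (by omega)]
        push_cast
        rw [e, hf]
        field_simp) r (by rw [← e]; exact hr)
    refine ⟨hcell.1, ?_⟩
    have h2 := hcell.2
    have ev : v r = f ((l : ℝ) / N) + deriv v r * (r - (l : ℝ) / N) := by
      rw [hvd, interpFn_deriv c hlN hr, interpFn_cell c hlN (Ioo_subset_Icc_self hr), hcf l hl]
      field_simp
      ring
    rw [ev]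
    exact h2
  have cN : ∀ l : ℕ, M ≤ l → l < N → Set.uIcc ((l : ℝ) / N) (((l + 1 : ℕ) : ℝ) / N) ⊆ Set.Ioi 0 := by
    intro l hl hlN
    rw [uIcc_of_le (by push_cast; exact cell_le l)]
    intro r hr
    have : (0 : ℝ) < l := by exact_mod_cast (by omega : 0 < l)
    exact lt_of_lt_of_le (by positivity) hr.1
  have cE : ContinuousOn (fun r : ℝ => C * (1 / N) / r ^ 2) (Set.Ioi 0) := by
    apply ContinuousOn.div continuousOn_const (continuousOn_pow 2)
    intro r hr
    have : (0 : ℝ) < r := hr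
    positivity
  have cF' : ContinuousOn (fun r => r ^ (p + 2) * (Ffun (m + 1) k (-m) k r) ^ 2) (Set.Ioi 0) :=
    (continuousOn_pow _).mul ((Ffun_cont _ _ _ k).pow 2)
  have cF : ContinuousOn (fun r => r ^ p * (f r) ^ 2) (Set.Ioi 0) :=
    (continuousOn_pow _).mul ((Ffun_cont _ _ _ k).pow 2)
  have iE : IntervalIntegrable (fun r : ℝ => C * (1 / N) / r ^ 2) volume r0 1 :=
    (cE.mono hpos).intervalIntegrable
  have iF' := (cF'.mono hpos).intervalIntegrable (μ := volume)
  have hEint : ∫ r in r0..1, C * (1 / N) / r ^ 2 ≤ C / M := by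
    rw [intervalIntegral.integral_eq_sub_of_hasDerivAt (f := fun r => -(C * (1 / N)) * r⁻¹) _ iE]
    · have : (C * (1 / N)) * r0⁻¹ = C / M := by rw [hr0d]; field_simp
      have h3 : 0 ≤ C * (1 / N) := by positivity
      simp only [inv_one]
      linarith
    · intro r hr
      have := hpos r hr
      refine ((hasDerivAt_inv this.ne').const_mul (-(C * (1 / N)))).congr_deriv ?_
      field_simp
  have hD := exact_den p m k r0 hm hk0 hr0 hr1 hk
  have hNm := exact_num p m k r0 hm hr0 hr1 hk
  have k1 := intInt_deriv hv (p + 2) (Nat.zero_le M) hMN.le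
  have k2 := intInt_deriv hv (p + 2) hMN.le le_rfl
  have k3 := intInt_val hv p (Nat.zero_le N) hMN.le
  have k4 := intInt_val hv p hMN.le le_rfl
  refine ⟨v, hv, ?_, ?_, ?_⟩
  · have h := interpFn_cell c (k := N - 1) (N := N) (by omega) (x := 1)
    have e : ((N - 1 : ℕ) : ℝ) = N - 1 := by
      rw [Nat.cast_sub (by omega)]; simp
    rw [e] at h
    rw [hvd, h ⟨?_, ?_⟩, Nat.sub_add_cancel (by omega), hcf N hMN.le, hNN, z1]
    · ring
    · rw [div_le_one hN0]; linarith
    · simp [hNN]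
  · have hz : ∫ r in (((0 : ℕ) : ℝ) / N)..((M : ℝ) / N), r ^ (p + 2) * (deriv v r) ^ 2 ≤
        ∫ r in (((0 : ℕ) : ℝ) / N)..((M : ℝ) / N), (0 : ℝ) := by
      refine mono_cells (Nat.zero_le M) (fun l _ hl => intInt_deriv hv (p + 2) (Nat.le_succ l) (by omega))
        (fun l _ hl => Continuous.intervalIntegrable (by fun_prop) _ _) ?_
      intro l _ hl r hr
      rw [hvd, interpFn_deriv c (by omega) hr, hcM l (by omega), hcM (l + 1) (by omega)]
      simp
    have hmn : ∫ r in ((M : ℝ) / N)..((N : ℝ) / N), r ^ (p + 2) * (deriv v r) ^ 2 ≤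
        ∫ r in ((M : ℝ) / N)..((N : ℝ) / N), (r ^ (p + 2) * (Ffun (m + 1) k (-m) k r) ^ 2 + C * (1 / N) / r ^ 2) := by
      refine mono_cells hMN.le (fun l _ hl => intInt_deriv hv (p + 2) (Nat.le_succ l) (by omega))
        (fun l hl hlN => ((cF'.add cE).mono (cN l hl hlN)).intervalIntegrable) ?_
      intro l hl hlN r hr
      exact (hE l hl hlN r hr).1
    have hs := intervalIntegral.integral_add_adjacent_intervals k1 k2
    rw [hNN] at hs hmn
    rw [intervalIntegral.integral_add iF' iE, hNm, hD] at hmn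
    simp only [Nat.cast_zero, zero_div, intervalIntegral.integral_zero] at hz hs
    linarith
  · have hz : 0 ≤ ∫ r in (((0 : ℕ) : ℝ) / N)..((M : ℝ) / N), r ^ p * (v r) ^ 2 := by
      apply intervalIntegral.integral_nonneg
      · simp; positivity
      · intro r hr
        have : 0 ≤ r := by simpa using hr.1
        positivity
    have hmn : ∫ r in ((M : ℝ) / N)..((N : ℝ) / N), r ^ p * (f r) ^ 2 ≤
        ∫ r in ((M : ℝ) / N)..((N : ℝ) / N), (r ^ p * (v r) ^ 2 + C * (1 / N) / r ^ 2) := by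
      refine mono_cells hMN.le (fun l hl hlN => (cF.mono (cN l hl hlN)).intervalIntegrable)
        (fun l hl hlN => (intInt_val hv p (by omega) (by omega)).add
          ((cE.mono (cN l hl hlN)).intervalIntegrable)) ?_
      intro l hl hlN r hr
      exact (hE l hl hlN r hr).2
    have hs := intervalIntegral.integral_add_adjacent_intervals k3 k4
    rw [hNN] at hs hmn k4
    rw [intervalIntegral.integral_add k4 iE, hD] at hmn
    simp only [Nat.cast_zero, zero_div] at hz hs
    linarith

lemma den_pos (p : ℕ) {v : ℝ → ℝ} (hv : ContinuousOn v (Set.Icc 0 1))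
    (hx : ∃ x ∈ Set.Icc (0:ℝ) 1, v x ≠ 0) : 0 < ∫ r in (0:ℝ)..1, r ^ p * (v r) ^ 2 := by
  refine intervalIntegral.integral_pos one_pos ((continuousOn_pow p).mul (hv.pow 2)) ?_ ?_
  · intro x hx
    have := hx.1
    positivity
  · by_contra! hcon
    have h0 : ∀ c ∈ Set.Ioc (0:ℝ) 1, v c = 0 := by
      intro c hc
      have := hcon c ⟨hc.1.le, hc.2⟩
      have hp : 0 < c ^ p := pow_pos hc.1 p
      have : v c ^ 2 ≤ 0 := by
        by_contra! h
        have := mul_pos hp h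
        linarith
      exact pow_eq_zero_iff (two_ne_zero) |>.1 (le_antisymm this (sq_nonneg _))
    obtain ⟨x, hx, hvx⟩ := hx
    rcases hx.1.lt_or_eq with h | h
    · exact hvx (h0 x ⟨h, hx.2⟩)
    · subst h
      have hcl : closure (Set.Ioc (0:ℝ) 1) = Set.Icc 0 1 := closure_Ioc (by norm_num)
      have : Set.EqOn v (fun _ => 0) (Set.Icc 0 1) := by
        apply Set.EqOn.of_subset_closure (s := Set.Ioc 0 1) (fun c hc => h0 c hc) hv
          continuousOn_const Ioc_subset_Icc_self hcl.ge
      exact hvx (this hx)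

lemma S_upper (p N M : ℕ) (m k : ℝ) (hm : 2 * m = p + 1) (hM : 1 ≤ M) (hMN : M < N)
    (hk0 : 0 < k) (hk1 : k ≤ 1) (hk : k * Real.log ((M : ℝ) / N) = -π)
    (hpos : 2 ^ (p + 5) * ((m + 2) ^ 2) ^ 2 / M < -Real.log ((M : ℝ) / N) / 2) :
    SdiscN (p + 3) N ≤ ((m ^ 2 + k ^ 2) * (-Real.log ((M : ℝ) / N) / 2) + 2 ^ (p + 5) * ((m + 2) ^ 2) ^ 2 / M) /
      (-Real.log ((M : ℝ) / N) / 2 - 2 ^ (p + 5) * ((m + 2) ^ 2) ^ 2 / M) := by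
  obtain ⟨v, hv, hv1, hnum, hden⟩ := upper_main p N M m k hm hM hMN hk0 hk1 hk
  have hden0 : 0 < ∫ r in (0:ℝ)..1, r ^ p * (v r) ^ 2 := by linarith
  have hnn : ∀ w : ℝ → ℝ, 0 ≤ ∫ r in (0:ℝ)..1, r ^ (p + 2) * (deriv w r) ^ 2 := by
    intro w
    apply intervalIntegral.integral_nonneg zero_le_one
    intro r hr
    have := hr.1
    positivity
  unfold SdiscN
  refine csInf_le_of_le ⟨0, ?_⟩ ⟨v, hv, hv1, ?_, rfl⟩ ?_
  · rintro s ⟨w, -, -, -, rfl⟩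
    apply div_nonneg (hnn w)
    apply intervalIntegral.integral_nonneg zero_le_one
    intro r hr
    have := hr.1
    positivity
  · by_contra! hcon
    have : ∫ r in (0:ℝ)..1, r ^ p * (v r) ^ 2 = ∫ r in (0:ℝ)..1, (0 : ℝ) := by
      apply intervalIntegral.integral_congr
      intro r hr
      rw [uIcc_of_le zero_le_one] at hr
      simp [hcon r hr]
    simp [this] at hden0
  · show (∫ r in (0:ℝ)..1, r ^ (p + 2) * (deriv v r) ^ 2) / (∫ r in (0:ℝ)..1, r ^ p * (v r) ^ 2) ≤ _
    exact div_le_div₀ ((hnn v).trans hnum) hnum (by linarith) hden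

lemma S_lower (p N : ℕ) (m k A : ℝ) (hm : 2 * m = p + 1) (hN : 1 ≤ N) (hA : 0 < A) (hk : 0 < k)
    (hkA : k * A ≤ 1) (hkL : k * (Real.log N + 1 + A) = π)
    (hQ : ∀ a B : ℝ, 0 ≤ B ^ 2 / (p + 3) - (m ^ 2 + k ^ 2) * (a ^ 2 / (p + 1) + 2 * a * B / (p + 2)
        + B ^ 2 / (p + 3)) + (m - 1 / A) * (a + B) ^ 2) :
    m ^ 2 + k ^ 2 ≤ SdiscN (p + 3) N := by
  have hN0 : (0 : ℝ) < N := by exact_mod_cast hN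
  apply le_csInf
  · refine ⟨_, interpFn N (fun j => if j = 0 then 1 else 0), interpFn_mem _ _, ?_, ⟨0, by simp, ?_⟩, rfl⟩
    · have h := interpFn_cell (fun j => if j = 0 then (1:ℝ) else 0) (k := N - 1) (N := N) (by omega) (x := 1)
      have e : ((N - 1 : ℕ) : ℝ) = N - 1 := by
        rw [Nat.cast_sub (by omega)]; simp
      rw [e] at h
      rw [h ⟨?_, ?_⟩]
      · have : N - 1 + 1 ≠ 0 := by omega
        simp
      · rw [div_le_one hN0]; linarith
      · simp [div_self hN0.ne']
    · rw [interpFn_cell _ (k := 0) (by omega) ⟨by simp, by simp⟩]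
      simp
  · rintro s ⟨v, hv, hv1, hx, rfl⟩
    have := lower_main p N m k A hm hN hA hk hkA hkL hQ hv hv1
    have hd := den_pos p hv.1 hx
    show _ ≤ (∫ r in (0:ℝ)..1, r ^ (p + 2) * (deriv v r) ^ 2) / (∫ r in (0:ℝ)..1, r ^ p * (v r) ^ 2)
    rw [le_div_iff₀ hd]
    exact this

lemma lower_asymp (p : ℕ) (m : ℝ) (hm : 2 * m = p + 1) :
    ∃ lo : ℕ → ℝ, Tendsto lo atTop (nhds (π ^ 2)) ∧
      ∀ᶠ N : ℕ in atTop, lo N ≤ (SdiscN (p + 3) N - m ^ 2) * (Real.log N) ^ 2 := by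
  have hp0 : (0 : ℝ) ≤ p := by positivity
  have hm0 : 0 < m := by linarith
  obtain ⟨η, hη0, hη1, hη2⟩ : ∃ η : ℝ, 0 < η ∧ 4 * (η + η) ≤ m / 2 ∧
      18 * (η + η) ≤ (m + 1) / (2 * (2 * m + 1) ^ 2) := by
    have h1 : 0 < m / 2 := by positivity
    have h2 : 0 < (m + 1) / (2 * (2 * m + 1) ^ 2) := by positivity
    refine ⟨min (m / 2) ((m + 1) / (2 * (2 * m + 1) ^ 2)) / 36, by positivity, ?_, ?_⟩
    · have := min_le_left (m / 2) ((m + 1) / (2 * (2 * m + 1) ^ 2))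
      linarith
    · have := min_le_right (m / 2) ((m + 1) / (2 * (2 * m + 1) ^ 2))
      linarith
  have hlog : Tendsto (fun N : ℕ => Real.log (N : ℝ)) atTop atTop :=
    Real.tendsto_log_atTop.comp tendsto_natCast_atTop_atTop
  set A : ℝ := 1 / η with hA
  have hA0 : 0 < A := by positivity
  set k : ℕ → ℝ := fun N => π / (Real.log N + 1 + A) with hk
  have hden : Tendsto (fun N : ℕ => Real.log (N : ℝ) + 1 + A) atTop atTop :=
    tendsto_atTop_add_const_right _ _ (tendsto_atTop_add_const_right _ _ hlog)
  have hk0 : Tendsto k atTop (nhds 0) := hden.const_div_atTop π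
  have hkL : Tendsto (fun N => k N * Real.log N) atTop (nhds π) := by
    have h1 : Tendsto (fun N => π - k N * (1 + A)) atTop (nhds (π - 0 * (1 + A))) :=
      tendsto_const_nhds.sub (hk0.mul_const _)
    rw [zero_mul, sub_zero] at h1
    refine h1.congr' ?_
    filter_upwards [hden.eventually_gt_atTop 0] with N hN
    simp only [hk]
    field_simp
    ring
  refine ⟨fun N => (k N * Real.log N) ^ 2, hkL.pow 2, ?_⟩
  have hk2 : Tendsto (fun N => k N ^ 2) atTop (nhds 0) := by simpa using hk0.pow 2
  have hkA : Tendsto (fun N => k N * A) atTop (nhds 0) := by simpa using hk0.mul_const A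
  filter_upwards [hden.eventually_gt_atTop 0, eventually_ge_atTop 1,
    hk2.eventually_lt_const hη0, hkA.eventually_lt_const one_pos] with N hN hN1 hk2N hkAN
  have hkp : 0 < k N := div_pos Real.pi_pos hN
  have h := S_lower p N m (k N) A hm hN1 hA0 hkp hkAN.le (div_mul_cancel₀ _ hN.ne') (by
    have hAη : 1 / A = η := by rw [hA]; simp
    rw [hAη]
    apply quad_pos p m _ _ hm (sq_nonneg _) hη0.le
    · linarith
    · linarith)
  rw [mul_pow]
  gcongr
  linarith

lemma upper_asymp (p : ℕ) (m : ℝ) (hm : 2 * m = p + 1) :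
    ∃ hi : ℕ → ℝ, Tendsto hi atTop (nhds (4 * π ^ 2)) ∧
      ∀ᶠ N : ℕ in atTop, (SdiscN (p + 3) N - m ^ 2) * (Real.log N) ^ 2 ≤ hi N := by
  have hlog : Tendsto (fun N : ℕ => Real.log (N : ℝ)) atTop atTop :=
    Real.tendsto_log_atTop.comp tendsto_natCast_atTop_atTop
  set C : ℝ := 2 ^ (p + 5) * ((m + 2) ^ 2) ^ 2 with hC
  have hC0 : 0 ≤ C := by positivity
  set L : ℕ → ℝ := fun N => Real.log N with hL
  set l : ℕ → ℝ := fun N => L N / 2 - Real.log 2 with hl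
  set ε : ℕ → ℝ := fun N => C * Real.exp (-(1 / 2) * L N) with hε
  have hlt : Tendsto l atTop atTop :=
    tendsto_atTop_add_const_right _ _ (hlog.atTop_div_const (by norm_num))
  have hLε : Tendsto (fun N => L N * ε N) atTop (nhds 0) := by
    have h1 := (tendsto_pow_mul_exp_neg_atTop_nhds_zero 1).comp (hlog.atTop_div_const (r := 2) (by norm_num))
    have h2 := h1.const_mul (2 * C)
    rw [mul_zero] at h2
    refine h2.congr (fun N => ?_)
    simp only [Function.comp, hε, pow_one, hL]
    have : -(1 / 2) * Real.log N = -(Real.log N / 2) := by ring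
    rw [this]; ring
  have hε0 : Tendsto ε atTop (nhds 0) := by
    have h1 := hLε.mul (hlog.const_div_atTop 1)
    rw [mul_zero] at h1
    refine h1.congr' ?_
    filter_upwards [hlog.eventually_gt_atTop 0] with N hN
    field_simp
  have hLinv : Tendsto (fun N => 1 / L N) atTop (nhds 0) := hlog.const_div_atTop 1
  have hlL : Tendsto (fun N => l N / L N) atTop (nhds (1 / 2)) := by
    have h1 : Tendsto (fun N => 1 / 2 - Real.log 2 * (1 / L N)) atTop (nhds (1 / 2 - Real.log 2 * 0)) :=
      tendsto_const_nhds.sub (hLinv.const_mul _)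
    rw [mul_zero, sub_zero] at h1
    refine h1.congr' ?_
    filter_upwards [hlog.eventually_gt_atTop 0] with N hN
    simp only [hl]
    field_simp
  refine ⟨fun N => (π ^ 2 / (2 * (l N / L N)) + (1 + m ^ 2) * (L N * ε N)) /
      ((l N / L N) / 2 - ε N * (1 / L N)), ?_, ?_⟩
  · have h1 : Tendsto (fun N => (π ^ 2 / (2 * (l N / L N)) + (1 + m ^ 2) * (L N * ε N)) /
      ((l N / L N) / 2 - ε N * (1 / L N))) atTop (nhds ((π ^ 2 / (2 * (1 / 2)) + (1 + m ^ 2) * 0) /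
      ((1 / 2) / 2 - 0 * 0))) := by
      apply Tendsto.div
      · exact (tendsto_const_nhds.div (hlL.const_mul 2) (by norm_num)).add (hLε.const_mul _)
      · exact (hlL.div_const 2).sub (hε0.mul hLinv)
      · norm_num
    convert h1 using 2
    ring
  · filter_upwards [hlog.eventually_gt_atTop 0, hlt.eventually_ge_atTop π,
      hε0.eventually_lt_const (show (0 : ℝ) < 1 by norm_num), eventually_ge_atTop 9] with N hLN hlN hεN hN9
    have hN0 : (0 : ℝ) < N := by exact_mod_cast (by omega : 0 < N)
    set M : ℕ := Nat.sqrt N + 1 with hM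
    have hM1 : Nat.sqrt N * Nat.sqrt N ≤ N := Nat.sqrt_le N
    have hM2 : N < M * M := Nat.lt_succ_sqrt N
    have hs3 : 3 ≤ Nat.sqrt N := Nat.le_sqrt.2 hN9
    have hMN : M < N := by nlinarith
    have hM0 : (0 : ℝ) < M := by positivity
    have e1 : (N : ℝ) ≤ (M : ℝ) ^ 2 := by
      rw [pow_two]; exact_mod_cast hM2.le
    have e2 : (M : ℝ) ^ 2 ≤ 4 * N := by
      have : M * M ≤ 4 * N := by nlinarith
      rw [pow_two]; exact_mod_cast this
    have g1 : L N ≤ 2 * Real.log M := by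
      have := Real.log_le_log hN0 e1
      rwa [Real.log_pow] at this
    have g2 : 2 * Real.log M ≤ 2 * Real.log 2 + L N := by
      have := Real.log_le_log (by positivity) e2
      rw [Real.log_pow, Real.log_mul (by norm_num) hN0.ne', show (4:ℝ) = 2 ^ 2 by norm_num, Real.log_pow] at this
      exact_mod_cast this
    have hlog0 : -Real.log ((M : ℝ) / N) = L N - Real.log M := by
      rw [Real.log_div hM0.ne' hN0.ne']; ring
    set L0 := -Real.log ((M : ℝ) / N) with hL0
    have hL0l : l N ≤ L0 := by simp only [hl]; linarith
    have hπ3 := Real.pi_gt_three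
    have hL0p : 0 < L0 := by linarith
    have hεM : C / M ≤ ε N := by
      have : Real.exp (1 / 2 * L N) ≤ M := by
        rw [← Real.exp_log hM0]; apply Real.exp_le_exp.2; linarith
      simp only [hε]
      rw [neg_mul, Real.exp_neg, div_eq_mul_inv]
      gcongr
    have hεnn : 0 ≤ ε N := by positivity
    have h := S_upper p N M m (π / L0) hm (by omega) hMN (by positivity)
      (by rw [div_le_one hL0p]; linarith)
      (by have : Real.log ((M : ℝ) / N) = -L0 := by rw [hL0]; ring
          rw [this]; field_simp)
      (by rw [← hL0, ← hC]; linarith)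
    rw [← hL0, ← hC] at h
    have hD : 0 < L0 / 2 - C / M := by linarith
    have hD2 : 0 < l N / 2 - ε N := by linarith
    have h2 : SdiscN (p + 3) N - m ^ 2 ≤ (π ^ 2 / (2 * l N) + (1 + m ^ 2) * ε N) / (l N / 2 - ε N) := by
      calc SdiscN (p + 3) N - m ^ 2 ≤ ((m ^ 2 + (π / L0) ^ 2) * (L0 / 2) + C / M) / (L0 / 2 - C / M) - m ^ 2 := by
            linarith
        _ = (π ^ 2 / (2 * L0) + (1 + m ^ 2) * (C / M)) / (L0 / 2 - C / M) := by
            rw [eq_div_iff hD.ne', sub_mul, div_mul_cancel₀ _ hD.ne']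
            field_simp
            ring
        _ ≤ _ := by
            have hl0 : 0 < l N := by linarith
            gcongr
    have h3 := mul_le_mul_of_nonneg_right h2 (sq_nonneg (L N))
    refine h3.trans (le_of_eq ?_)
    have hl0 : 0 < l N := by linarith
    have hLN' : 0 < L N := hLN
    have e3 : (l N / L N) / 2 - ε N * (1 / L N) = (l N / 2 - ε N) / L N := by
      field_simp
    rw [e3]
    field_simp

/-- `S^n + π²/|log h|² + o(1/|log h|²) ≤ S^n_h ≤ S^n + (n+1)²π²/(4|log h|²) + o(1/|log h|²)`,
expressed via liminf and limsup of `(S^n_h − S^n)·(log h)²` as `N → ∞` (`h = 1/N`). -/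
theorem discrete_hardy_nd_asymptotics (n : ℕ) (hn : 3 ≤ n) :
    π ^ 2 ≤ Filter.liminf
        (fun N : ℕ => (SdiscN n N - ((n : ℝ) - 2) ^ 2 / 4) * (Real.log (1 / (N : ℝ))) ^ 2)
        Filter.atTop ∧
    Filter.limsup
        (fun N : ℕ => (SdiscN n N - ((n : ℝ) - 2) ^ 2 / 4) * (Real.log (1 / (N : ℝ))) ^ 2)
        Filter.atTop ≤ ((n : ℝ) + 1) ^ 2 * π ^ 2 / 4 := by
  obtain ⟨p, rfl⟩ : ∃ p, n = p + 3 := ⟨n - 3, by omega⟩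
  set m : ℝ := ((p : ℝ) + 1) / 2 with hmd
  have hm : 2 * m = p + 1 := by rw [hmd]; ring
  obtain ⟨lo, hlo, hlo'⟩ := lower_asymp p m hm
  obtain ⟨hi, hhi, hhi'⟩ := upper_asymp p m hm
  have e : (fun N : ℕ => (SdiscN (p + 3) N - (((p + 3 : ℕ) : ℝ) - 2) ^ 2 / 4) * (Real.log (1 / (N : ℝ))) ^ 2)
      = fun N : ℕ => (SdiscN (p + 3) N - m ^ 2) * (Real.log N) ^ 2 := by
    funext N
    have : (((p + 3 : ℕ) : ℝ) - 2) ^ 2 / 4 = m ^ 2 := by rw [hmd]; push_cast; ring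
    rw [this]
    simp
  rw [e]
  have hbA : IsBoundedUnder (· ≤ ·) atTop
      (fun N : ℕ => (SdiscN (p + 3) N - m ^ 2) * (Real.log N) ^ 2) :=
    hhi.isBoundedUnder_le.mono_le hhi'
  have hbB : IsBoundedUnder (· ≥ ·) atTop
      (fun N : ℕ => (SdiscN (p + 3) N - m ^ 2) * (Real.log N) ^ 2) :=
    hlo.isBoundedUnder_ge.mono_ge hlo'
  constructor
  · rw [← hlo.liminf_eq]
    exact liminf_le_liminf hlo' hlo.isBoundedUnder_ge hbA.isCoboundedUnder_ge
  · have h1 := limsup_le_limsup hhi' hbB.isCoboundedUnder_le hhi.isBoundedUnder_le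
    rw [hhi.limsup_eq] at h1
    refine h1.trans ?_
    have hp0 : (0 : ℝ) ≤ p := by positivity
    push_cast
    have : (16 : ℝ) ≤ ((p : ℝ) + 3 + 1) ^ 2 := by nlinarith
    nlinarith [sq_nonneg π]
end
end
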